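/- arXiv:0705.3822 — 4 statements merged into one kernel-verified Lean document; each statement's English description precedes it below -/
import Mathlib

section
/- Let Y be a complete length space, q ∈ Y, δ > 0, and let C : [0,1] → Y be a rectifiable loop (C(0) = C(1)) whose image is contained in the open ball B(q,δ). Then there exist finitely many loops C₁, …, C_k based at q, each of length strictly less than 2δ and with image contained in B(q,δ), such that C is freely homotopic within B(q,δ) to the concatenation C₁·C₂·…·C_k. -/
/- Common definitions: path length, length/geodesic spaces, δ-covering groups,
   covering spectra, cut-off covering groups and spectra, free homotopy,
   loops-to-infinity. -/

open Metric Filter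
open scoped NNReal ENNReal unitInterval

attribute [local instance] Path.Homotopic.setoid

/-- The length (total variation) of a path in a metric space. -/
noncomputable def pathLength {X : Type*} [MetricSpace X] {x y : X} (γ : Path x y) : ℝ≥0∞ :=
  eVariationOn γ Set.univ

/-- A metric space is a length space if the distance between any two points is the
infimum of the lengths of paths joining them. -/
def IsLengthSpace (X : Type*) [MetricSpace X] : Prop :=
  ∀ x y : X, ENNReal.ofReal (dist x y) = ⨅ γ : Path x y, pathLength γ

/-- A metric space is a geodesic space if any two points are joined by a
distance-realizing path. -/
def IsGeodesicSpace (X : Type*) [MetricSpace X] : Prop :=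
  ∀ x y : X, ∃ γ : Path x y, pathLength γ = ENNReal.ofReal (dist x y)

/-- The element of the fundamental group at `p` represented by the loop
`α⁻¹ · β · α` (i.e. follow `α` from `p` to `y`, the loop `β` at `y`, then `α` back). -/
noncomputable def loopClass {X : Type*} [TopologicalSpace X] {p y : X}
    (α : Path p y) (β : Path y y) : FundamentalGroup X p :=
  FundamentalGroup.fromPath (X := TopCat.of X) ⟦(α.trans β).trans α.symm⟧

/-- The δ-covering group `π₁(X, δ, p)`: the normal subgroup of `π₁(X,p)` generated by
classes of loops `α⁻¹·β·α` with `β` lying in some open ball of radius `δ`. -/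
noncomputable def coveringGroup (X : Type*) [MetricSpace X] (p : X) (δ : ℝ) :
    Subgroup (FundamentalGroup X p) :=
  Subgroup.normalClosure
    {g | ∃ (y : X) (β : Path y y) (α : Path p y),
      (∃ c : X, ∀ t, β t ∈ Metric.ball c δ) ∧ g = loopClass α β}

/-- The covering spectrum of `X` (with basepoint `p`). -/
def covSpec (X : Type*) [MetricSpace X] (p : X) : Set ℝ :=
  {δ | 0 < δ ∧ ∀ δ' > δ, coveringGroup X p δ' ≠ coveringGroup X p δ}

/-- The `R` cut-off δ-covering group `π₁^{cut}(X, δ, R, x)`: the normal subgroup of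
`π₁(X,x)` generated by classes of loops `α⁻¹·β·α` with `β` lying in some open ball of
radius `δ` or in the complement of the closed ball `B̄(x,R)`. -/
noncomputable def cutCoveringGroup (X : Type*) [MetricSpace X] (x : X) (δ R : ℝ) :
    Subgroup (FundamentalGroup X x) :=
  Subgroup.normalClosure
    {g | ∃ (y : X) (β : Path y y) (α : Path x y),
      ((∃ c : X, ∀ t, β t ∈ Metric.ball c δ) ∨ (∀ t, β t ∉ Metric.closedBall x R)) ∧
      g = loopClass α β}

/-- The `R` cut-off covering spectrum of `(X,x)`. -/
def cutCovSpec (X : Type*) [MetricSpace X] (x : X) (R : ℝ) : Set ℝ :=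
  {δ | 0 < δ ∧ ∀ δ' > δ, cutCoveringGroup X x δ' R ≠ cutCoveringGroup X x δ R}

/-- Two loops are freely homotopic: there is a homotopy through (not necessarily
based) loops from one to the other. -/
def FreelyHomotopic {X : Type*} [TopologicalSpace X] {a b : X}
    (γ₀ : Path a a) (γ₁ : Path b b) : Prop :=
  ∃ H : C(I × I, X),
    (∀ t, H (0, t) = γ₀ t) ∧ (∀ t, H (1, t) = γ₁ t) ∧ ∀ s, H (s, 0) = H (s, 1)

/-- Two loops are freely homotopic within a subset `A`: the homotopy stays in `A`. -/
def FreelyHomotopicIn {X : Type*} [TopologicalSpace X] (A : Set X) {a b : X}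
    (γ₀ : Path a a) (γ₁ : Path b b) : Prop :=
  ∃ H : C(I × I, X),
    (∀ t, H (0, t) = γ₀ t) ∧ (∀ t, H (1, t) = γ₁ t) ∧ (∀ s, H (s, 0) = H (s, 1)) ∧
    ∀ p, H p ∈ A

/-- A loop has the loops-to-infinity property: for every compact set it is freely
homotopic to a loop outside that set. -/
def LoopToInfinity {X : Type*} [TopologicalSpace X] {a : X} (γ : Path a a) : Prop :=
  ∀ K : Set X, IsCompact K →
    ∃ (b : X) (η : Path b b), (∀ t, η t ∉ K) ∧ FreelyHomotopic γ η

/-- A space has the loops-to-infinity property if all of its loops do. -/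
def LoopsToInfinity (X : Type*) [TopologicalSpace X] : Prop :=
  ∀ (a : X) (γ : Path a a), LoopToInfinity γ

/-- Concatenation of a finite list of loops based at `q`. -/
noncomputable def loopConcat {X : Type*} [TopologicalSpace X] (q : X) :
    List (Path q q) → Path q q
  | [] => Path.refl q
  | γ :: rest => γ.trans (loopConcat q rest)

/-- A space is semilocally simply connected if every point has a neighborhood in which
every loop is null-homotopic in the whole space. -/
def SemilocallySimplyConnected (X : Type*) [TopologicalSpace X] : Prop :=
  ∀ x : X, ∃ U ∈ nhds x, ∀ (y : X) (γ : Path y y), (∀ t, γ t ∈ U) →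
    γ.Homotopic (Path.refl y)

/-- A pointed ε-Hausdorff approximation. -/
def IsPointedHausdorffApprox {Z₁ Z₂ : Type*} [MetricSpace Z₁] [MetricSpace Z₂]
    (f : Z₁ → Z₂) (p₁ : Z₁) (p₂ : Z₂) (ε : ℝ) : Prop :=
  f p₁ = p₂ ∧ (∀ a b : Z₁, |dist (f a) (f b) - dist a b| < ε) ∧
    ∀ z : Z₂, ∃ a : Z₁, dist z (f a) ≤ ε

instance coveringGroup_normal (X : Type*) [MetricSpace X] (p : X) (δ : ℝ) :
    (coveringGroup X p δ).Normal :=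
  Subgroup.normalClosure_normal

instance cutCoveringGroup_normal (X : Type*) [MetricSpace X] (x : X) (δ R : ℝ) :
    (cutCoveringGroup X x δ R).Normal :=
  Subgroup.normalClosure_normal

section Aux
open Set

lemma aux_len_symm {X : Type*} [MetricSpace X] {x y : X} (γ : Path x y) :
    pathLength γ.symm ≤ pathLength γ := by
  unfold pathLength
  exact eVariationOn.comp_le_of_antitoneOn γ (s := univ) (t := univ) unitInterval.symm
    (fun a _ b _ h => by simpa using h) (fun _ _ => mem_univ _)

lemma aux_len_subpath {X : Type*} [MetricSpace X] {x y : X} (γ : Path x y) {s t : I}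
    (h : s ≤ t) : pathLength (γ.subpath s t) ≤ eVariationOn γ (Icc s t) := by
  unfold pathLength
  refine eVariationOn.comp_le_of_monotoneOn γ (s := Icc s t) (t := univ) (Icc.convexComb s t)
    (fun a _ b _ hab => ?_) (fun u _ => ⟨Icc.le_convexComb h u, Icc.convexComb_le h u⟩)
  rw [← Subtype.coe_le_coe, Icc.coe_convexComb, Icc.coe_convexComb]
  have h1 : (s : ℝ) ≤ t := h
  have h2 : (a : ℝ) ≤ b := hab
  nlinarith

lemma aux_len_trans {X : Type*} [MetricSpace X] {x y z : X} (γ : Path x y) (η : Path y z) :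
    pathLength (γ.trans η) ≤ pathLength γ + pathLength η := by
  unfold pathLength
  let h : I := ⟨1/2, by norm_num, by norm_num⟩
  have hu : (univ : Set I) = Iic h ∪ Ici h := by simp
  rw [hu, eVariationOn.union (γ.trans η) (x := h) ⟨mem_Iic.2 le_rfl, fun _ hx => hx⟩
    ⟨mem_Ici.2 le_rfl, fun _ hx => hx⟩]
  refine add_le_add ?_ ?_
  · rw [eVariationOn.congr (g := γ ∘ fun t : I => projIcc 0 1 zero_le_one (2 * (t : ℝ)))]
    · exact eVariationOn.comp_le_of_monotoneOn γ _
        (fun a _ b _ hab => monotone_projIcc _ (by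
          have h2 : (a : ℝ) ≤ b := hab
          linarith)) (by intro; simp)
    · intro t ht
      have ht' : (t : ℝ) ≤ 1/2 := ht
      rw [Path.trans_apply, dif_pos ht']
      simp only [Function.comp]
      congr 1
      rw [projIcc_of_mem]
  · rw [eVariationOn.congr (g := η ∘ fun t : I => projIcc 0 1 zero_le_one (2 * (t : ℝ) - 1))]
    · exact eVariationOn.comp_le_of_monotoneOn η _
        (fun a _ b _ hab => monotone_projIcc _ (by
          have h2 : (a : ℝ) ≤ b := hab
          linarith)) (by intro; simp)
    · intro t ht
      have ht' : 1/2 ≤ (t : ℝ) := ht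
      have ht1 := t.2.2
      rcases eq_or_lt_of_le ht' with h0 | h0
      · simp [Path.trans_apply, ← h0]
      · rw [Path.trans_apply, dif_neg (by linarith)]
        simp only [Function.comp]
        congr 1
        rw [projIcc_of_mem]

lemma aux_concat_append {X : Type*} [TopologicalSpace X] (q : X) (L : List (Path q q))
    (γ : Path q q) : (loopConcat q (L ++ [γ])).Homotopic ((loopConcat q L).trans γ) := by
  rw [← Path.Homotopic.Quotient.eq]
  induction L with
  | nil => simp [loopConcat]
  | cons a L ih =>
    simp only [List.cons_append, loopConcat, Path.Homotopic.Quotient.mk_trans] at ih ⊢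
    rw [ih, Path.Homotopic.Quotient.trans_assoc]

/-- free homotopy, as maps on the interval -/
def FreeRel {X : Type*} [TopologicalSpace X] (f g : C(I, X)) : Prop :=
  ContinuousMap.HomotopicWith f g (fun h => h 0 = h 1)

lemma aux_free_of_homotopic {X : Type*} [TopologicalSpace X] {x : X} {γ η : Path x x}
    (h : γ.Homotopic η) : FreeRel (γ : C(I, X)) (η : C(I, X)) := by
  obtain ⟨F⟩ := h
  refine ⟨⟨F.toHomotopy, fun t => ?_⟩⟩
  have h0 := F.source t
  have h1 := F.target t
  exact h0.trans h1.symm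

lemma aux_free_conj {X : Type*} [TopologicalSpace X] {q y : X} (α : Path q y) (C : Path y y) :
    FreeRel (((α.trans C).trans α.symm : Path q q) : C(I, X)) (C : C(I, X)) := by
  let P := (α.trans C).trans α.symm
  have hP : P = (α.trans C).trans α.symm := rfl
  refine ⟨⟨⟨⟨fun p => P.extend ((p.1 : ℝ)/4 + p.2 * (1 - p.1/2 - p.1/4)), ?_⟩, ?_, ?_⟩, ?_⟩⟩
  · exact P.continuous_extend.comp (by fun_prop)
  · intro t
    simp [P]
  · intro t
    have h0 := t.2.1
    have h1 := t.2.2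
    have hm : (1:ℝ)/4 + t * (1 - 1/2 - 1/4) ∈ I := ⟨by linarith, by linarith⟩
    have e : P.extend ((1:ℝ)/4 + t * (1 - 1/2 - 1/4)) = C t := by
      rw [P.extend_apply hm, hP, Path.trans_apply, dif_pos (by simp only; linarith)]
      rw [Path.trans_apply]
      split_ifs with hc
      · have : (t:ℝ) = 0 := by simp only at hc; linarith
        have ht : t = 0 := Subtype.ext this
        subst ht
        rw [C.source]
        convert α.target using 2
        apply Subtype.ext
        norm_num
      · congr 1
        apply Subtype.ext
        simp only
        ring
    simpa using e
  · intro s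
    have h0 := s.2.1
    have h1 := s.2.2
    have m0 : (s:ℝ)/4 ∈ I := ⟨by linarith, by linarith⟩
    have m1 : 1 - (s:ℝ)/2 ∈ I := ⟨by linarith, by linarith⟩
    have e0 : P.extend ((s:ℝ)/4) = α s := by
      rw [P.extend_apply m0, hP, Path.trans_apply, dif_pos (by simp only; linarith)]
      rw [Path.trans_apply, dif_pos (by simp only; linarith)]
      congr 1
      apply Subtype.ext
      simp only
      ring
    have e1 : P.extend (1 - (s:ℝ)/2) = α s := by
      rw [P.extend_apply m1, hP, Path.trans_apply]
      split_ifs with hc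
      · have : (s:ℝ) = 1 := by simp only at hc; linarith
        have hs : s = 1 := Subtype.ext this
        subst hs
        rw [α.target]
        convert (α.trans C).target using 2
        apply Subtype.ext
        norm_num
      · rw [Path.symm_apply, Function.comp_apply]
        congr 1
        apply Subtype.ext
        simp only [unitInterval.coe_symm_eq]
        ring
    have e2 : ((s:ℝ)/4 + 1 * (1 - s/2 - s/4)) = 1 - (s:ℝ)/2 := by ring
    change P.extend ((s:ℝ)/4 + ((0:I):ℝ) * (1 - s/2 - s/4)) =
      P.extend ((s:ℝ)/4 + ((1:I):ℝ) * (1 - s/2 - s/4))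
    simp only [Icc.coe_zero, Icc.coe_one]
    rw [e2, e1, zero_mul, add_zero, e0]

lemma aux_free_conj' {X : Type*} [TopologicalSpace X] {q : X} (S : X → Prop)
    (B : ∀ x, S x → Path q x) {y z : X} (hy : S y) (hz : S z) (h : y = z) (C : Path y z) :
    FreeRel ((((B y hy).trans C).trans (B z hz).symm : Path q q) : C(I, X)) (C : C(I, X)) := by
  subst h
  exact aux_free_conj _ _

lemma aux_partition {X : Type*} [MetricSpace X] {y z : X} (C : Path y z)
    (hC : pathLength C ≠ ⊤) (ε : ℝ≥0∞) (hε : 0 < ε) :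
    ∃ t : ℕ → I, t 0 = 0 ∧ Monotone t ∧ (∃ n, t n = 1) ∧
      ∀ n, eVariationOn C (Icc (t n) (t (n+1))) < ε := by
  have hb : BoundedVariationOn C univ := hC
  have hε2 : 0 < ε / 2 := ENNReal.half_pos hε.ne'
  let c : I → Set I := fun x => interior {u | eVariationOn C (Icc u x) < ε / 2 ∧
    eVariationOn C (Icc x u) < ε / 2}
  have hc : ∀ x, x ∈ c x := by
    intro x
    rw [mem_interior_iff_mem_nhds]
    have h1 := hb.tendsto_eVariationOn_Icc_zero_left (x := x) C.continuous.continuousWithinAt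
    have h2 := hb.tendsto_eVariationOn_Icc_zero_right x C.continuous.continuousWithinAt
    simp only [univ_inter, nhdsWithin_univ] at h1 h2
    filter_upwards [h1.eventually_lt_const hε2, h2.eventually_lt_const hε2] with u a b
    exact ⟨a, b⟩
  obtain ⟨t, t0, tm, ⟨n, hn⟩, ht⟩ := exists_monotone_Icc_subset_open_cover_unitInterval (c := c)
    (fun _ => isOpen_interior) (fun x _ => mem_iUnion.2 ⟨x, hc x⟩)
  refine ⟨t, t0, tm, ⟨n, hn n le_rfl⟩, fun m => ?_⟩
  obtain ⟨x, hx⟩ := ht m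
  have hle := tm (Nat.le_succ m)
  have ha := (interior_subset (hx (left_mem_Icc.2 hle))).1
  have hb' := (interior_subset (hx (right_mem_Icc.2 hle))).2
  have hs : eVariationOn C (Icc (t m) x) + eVariationOn C (Icc x (t (m+1))) < ε := by
    calc _ < ε / 2 + ε / 2 := ENNReal.add_lt_add ha hb'
      _ = ε := ENNReal.add_halves ε
  refine lt_of_le_of_lt ?_ hs
  rcases le_total x (t m) with h | h
  · exact (eVariationOn.mono _ (Icc_subset_Icc h le_rfl)).trans le_add_self
  rcases le_total (t (m+1)) x with h' | h'
  · exact (eVariationOn.mono _ (Icc_subset_Icc le_rfl h')).trans le_self_add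
  · have := eVariationOn.Icc_add_Icc C (s := univ) h h' (mem_univ _)
    simp only [univ_inter] at this
    rw [this]

lemma aux_core {X : Type*} [MetricSpace X] (q : X) {y : X} (C : Path y y)
    (hC : pathLength C ≠ ⊤) (D ε K : ℝ≥0∞) (hε : 0 < ε) (hK : D + ε + D ≤ K)
    (hs : ∀ x, x ∈ range C → ∃ α : Path q x, pathLength α < D) :
    ∃ L : List (Path q q), (∀ γ ∈ L, pathLength γ < K) ∧
      FreeRel (C : C(I, X)) (loopConcat q L : C(I, X)) := by
  choose B hB using hs
  obtain ⟨t, t0, tm, ⟨N, hN⟩, ht⟩ := aux_partition C hC ε hε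
  let A : ∀ s, Path q (C s) := fun s => B (C s) (mem_range_self s)
  have key : ∀ n, ∃ L : List (Path q q), (∀ γ ∈ L, pathLength γ < K) ∧
      (((A (t 0)).trans (C.subpath (t 0) (t n))).trans (A (t n)).symm).Homotopic
        (loopConcat q L) := by
    intro n
    induction n with
    | zero =>
      refine ⟨[], by simp, ?_⟩
      rw [← Path.Homotopic.Quotient.eq]
      simp [loopConcat]
    | succ n ih =>
      obtain ⟨L, hL, hh⟩ := ih
      refine ⟨L ++ [((A (t n)).trans (C.subpath (t n) (t (n+1)))).trans (A (t (n+1))).symm],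
        ?_, ?_⟩
      · intro γ hγ
        rw [List.mem_append, List.mem_singleton] at hγ
        rcases hγ with hγ | rfl
        · exact hL γ hγ
        · refine lt_of_lt_of_le ?_ hK
          refine (aux_len_trans _ _).trans_lt (ENNReal.add_lt_add ?_ ?_)
          · refine (aux_len_trans _ _).trans_lt (ENNReal.add_lt_add (hB _ _) ?_)
            exact (aux_len_subpath C (tm (Nat.le_succ n))).trans_lt (ht n)
          · exact (aux_len_symm _).trans_lt (hB _ _)
      · refine Path.Homotopic.trans ?_ (aux_concat_append q L _).symm
        have h2 : ((C.subpath (t 0) (t n)).trans (C.subpath (t n) (t (n+1)))).Homotopic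
          (C.subpath (t 0) (t (n+1))) := ⟨Path.Homotopy.subpathTransSubpath C _ _ _⟩
        rw [← Path.Homotopic.Quotient.eq] at h2 hh ⊢
        simp only [Path.Homotopic.Quotient.mk_trans, Path.Homotopic.Quotient.mk_symm] at h2 hh ⊢
        rw [← hh, ← h2]
        simp only [Path.Homotopic.Quotient.trans_assoc]
        congr 2
        rw [← Path.Homotopic.Quotient.trans_assoc (Path.Homotopic.Quotient.symm _)]
        simp
  obtain ⟨L, hL, hh⟩ := key N
  refine ⟨L, hL, ?_⟩
  rw [t0, hN] at hh
  have e : (C.subpath 0 1 : C(I, X)) = (C : C(I, X)) := by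
    ext u
    simp
  have f1 := aux_free_conj' (· ∈ range C) B (mem_range_self 0) (mem_range_self 1) (by simp)
    (C.subpath 0 1)
  rw [e] at f1
  exact (ContinuousMap.HomotopicWith.symm f1).trans (aux_free_of_homotopic hh)

lemma aux_concat_map {X Z : Type*} [TopologicalSpace X] [TopologicalSpace Z] (f : X → Z)
    (hf : Continuous f) (q : X) (L : List (Path q q)) :
    (loopConcat q L).map hf = loopConcat (f q) (L.map fun γ => γ.map hf) := by
  induction L with
  | nil => rfl
  | cons a L ih => simp [loopConcat, ← ih, Path.map_trans]

end Aux

/-- In a complete length space, a rectifiable loop lying in an open ball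
`B(q,δ)` is freely homotopic within `B(q,δ)` to a concatenation of finitely many loops
based at `q`, each of length `< 2δ` and lying in `B(q,δ)`. -/
theorem loop_in_ball_freely_homotopic_to_short_loops
    {Y : Type*} [MetricSpace Y] [CompleteSpace Y] (hY : IsLengthSpace Y)
    (q : Y) (δ : ℝ) (hδ : 0 < δ) {y : Y} (C : Path y y)
    (hrect : pathLength C ≠ ⊤) (himg : ∀ t, C t ∈ Metric.ball q δ) :
    ∃ L : List (Path q q),
      (∀ γ ∈ L, pathLength γ < ENNReal.ofReal (2 * δ) ∧ ∀ t, γ t ∈ Metric.ball q δ) ∧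
      FreelyHomotopicIn (Metric.ball q δ) C (loopConcat q L) := by
  obtain ⟨t₀, -, ht₀⟩ := isCompact_univ.exists_isMaxOn (f := fun t => dist (C t) q)
    (Set.univ_nonempty (α := I)) (by fun_prop)
  set r := dist (C t₀) q with hr
  have hrδ : r < δ := himg t₀
  have hr0 : 0 ≤ r := dist_nonneg
  have hmax : ∀ t, dist (C t) q ≤ r := fun t => ht₀ (Set.mem_univ t)
  have hq : q ∈ Metric.ball q δ := Metric.mem_ball_self hδ
  have hy : y ∈ Metric.ball q δ := by simpa using himg 0
  let C' : Path (⟨y, hy⟩ : Metric.ball q δ) ⟨y, hy⟩ :=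
    { toFun := fun t => ⟨C t, himg t⟩
      continuous_toFun := by fun_prop
      source' := Subtype.ext C.source
      target' := Subtype.ext C.target }
  obtain ⟨L, hL, ⟨F⟩⟩ := aux_core (⟨q, hq⟩ : Metric.ball q δ) C' hrect
    (ENNReal.ofReal ((r + δ) / 2)) (ENNReal.ofReal (δ - r)) (ENNReal.ofReal (2 * δ))
    (ENNReal.ofReal_pos.2 (by linarith))
    (by
      rw [← ENNReal.ofReal_add (by linarith) (by linarith),
        ← ENNReal.ofReal_add (by linarith) (by linarith)]
      exact ENNReal.ofReal_le_ofReal (by linarith))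
    (by
      rintro _ ⟨t, rfl⟩
      have hlt : (⨅ γ : Path q (C t), pathLength γ) < ENNReal.ofReal ((r + δ) / 2) := by
        rw [← hY, ENNReal.ofReal_lt_ofReal_iff (by linarith), dist_comm]
        linarith [hmax t]
      obtain ⟨α, hα⟩ := iInf_lt_iff.1 hlt
      have hin : ∀ s, α s ∈ Metric.ball q δ := by
        intro s
        have h1 : edist (α s) (α 0) ≤ pathLength α :=
          eVariationOn.edist_le _ (Set.mem_univ _) (Set.mem_univ _)
        have h2 := h1.trans_lt hα
        rw [α.source, edist_dist, ENNReal.ofReal_lt_ofReal_iff (by linarith)] at h2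
        rw [Metric.mem_ball]
        linarith
      exact ⟨{ toFun := fun s => ⟨α s, hin s⟩
               continuous_toFun := by fun_prop
               source' := Subtype.ext α.source
               target' := Subtype.ext α.target }, hα⟩)
  refine ⟨L.map fun γ => γ.map continuous_subtype_val, ?_, ?_⟩
  · intro γ hγ
    obtain ⟨γ', hγ', rfl⟩ := List.mem_map.1 hγ
    exact ⟨hL γ' hγ', fun t => (γ' t).2⟩
  · refine ⟨⟨fun p => (F p : Y), by fun_prop⟩, ?_, ?_, ?_, ?_⟩
    · intro t
      simp [C']
    · intro t
      have e := aux_concat_map Subtype.val continuous_subtype_val (⟨q, hq⟩ : Metric.ball q δ) L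
      have e2 := congrArg Subtype.val (F.apply_one t)
      exact e2.trans (congrArg (fun γ : Path q q => γ t) e)
    · intro s
      exact congrArg Subtype.val (F.prop s)
    · intro p
      exact (F p).2
end

section
/- Let X be a complete locally compact length space with basepoint x and let R > 0. If δ ∈ CovSpec^R_cut(X,x), then 2δ belongs to the length spectrum of X: there exists a closed geodesic of length 2δ, namely a 2δ-periodic continuous map γ : ℝ → X satisfying d(γ(s),γ(t)) = |s − t| whenever |s − t| ≤ δ. -/
/- Common definitions: path length, length/geodesic spaces, δ-covering groups,
   covering spectra, cut-off covering groups and spectra, free homotopy,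
   loops-to-infinity. -/

open Metric Filter
open scoped NNReal ENNReal unitInterval

attribute [local instance] Path.Homotopic.setoid

open Topology

lemma ls_path {X : Type*} [MetricSpace X] (hX : IsLengthSpace X) (a b : X) {ε : ℝ} (hε : 0 < ε) :
    ∃ p : Path a b, ∀ s t : I, s ≤ t →
      dist a (p s) + dist (p s) (p t) + dist (p t) b ≤ dist a b + ε := by
  have h1 : (⨅ γ : Path a b, pathLength γ) < ENNReal.ofReal (dist a b + ε) := by
    rw [← hX a b]
    exact (ENNReal.ofReal_lt_ofReal_iff (by positivity)).2 (by linarith)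
  obtain ⟨p, hp⟩ := iInf_lt_iff.1 h1
  refine ⟨p, fun s t hst => ?_⟩
  let u : ℕ → I := fun n => match n with
    | 0 => 0
    | 1 => s
    | 2 => t
    | _ => 1
  have hu : Monotone u := by
    apply monotone_nat_of_le_succ
    intro n
    match n with
    | 0 => exact s.2.1
    | 1 => exact hst
    | 2 => exact t.2.2
    | (n+3) => exact le_refl _
  have h2 := eVariationOn.sum_le (f := (p : I → X)) (s := Set.univ) (n := 3) hu (fun i => Set.mem_univ _)
  simp only [Finset.sum_range_succ, Finset.sum_range_zero, zero_add] at h2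
  have h3 := h2.trans_lt hp
  simp only [u] at h3
  rw [p.source, p.target, edist_dist, edist_dist, edist_dist,
    ← ENNReal.ofReal_add dist_nonneg dist_nonneg, ← ENNReal.ofReal_add (by positivity) dist_nonneg,
    ENNReal.ofReal_lt_ofReal_iff (by positivity)] at h3
  rw [dist_comm a (p s), dist_comm (p s) (p t), dist_comm (p t) b]
  linarith

lemma ls_point {X : Type*} [MetricSpace X] (hX : IsLengthSpace X) (a b : X) {ε : ℝ} (hε : 0 < ε)
    {s : ℝ} (h0 : 0 ≤ s) (h1 : s ≤ dist a b) :
    ∃ m, dist a m = s ∧ dist m b ≤ dist a b - s + ε := by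
  obtain ⟨p, hp⟩ := ls_path hX a b hε
  have hc : Continuous (fun t => dist a (p t)) := by fun_prop
  obtain ⟨t, ht⟩ : s ∈ Set.range (fun t => dist a (p t)) := by
    apply mem_range_of_exists_le_of_exists_ge hc
    · exact ⟨0, by simpa using h0⟩
    · exact ⟨1, by simpa using h1⟩
  refine ⟨p t, ht, ?_⟩
  have := hp t t le_rfl
  simp only [dist_self] at this
  simp only at ht
  linarith

lemma ls_proper {X : Type*} [MetricSpace X] [CompleteSpace X] [LocallyCompactSpace X]
    (hX : IsLengthSpace X) : ProperSpace X := by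
  refine ⟨fun a r0 => ?_⟩
  by_contra hr0
  set S : Set ℝ := {r | IsCompact (closedBall a r)} with hS
  have hdown : ∀ r r', r' ≤ r → r ∈ S → r' ∈ S := fun r r' h hr =>
    IsCompact.of_isClosed_subset hr isClosed_closedBall (closedBall_subset_closedBall h)
  have hbdd : ∀ r ∈ S, r ≤ r0 := fun r hr => by
    by_contra h
    exact hr0 (hdown r r0 (by linarith) hr)
  have h0 : (0 : ℝ) ∈ S := by simp [hS]
  have hB : BddAbove S := ⟨r0, hbdd⟩
  set q := sSup S with hq
  have hq0 : 0 ≤ q := le_csSup hB h0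
  have hlt : ∀ r < q, r ∈ S := fun r hr => by
    obtain ⟨r', h, h'⟩ := exists_lt_of_lt_csSup ⟨0, h0⟩ hr
    exact hdown r' r h'.le h
  have hqS : q ∈ S := by
    refine isCompact_iff_totallyBounded_isComplete.2 ⟨?_, isClosed_closedBall.isComplete⟩
    rw [Metric.totallyBounded_iff]
    intro ε hε
    set r := max (q - ε / 4) 0 with hr
    have hrS : r ∈ S := by
      rcases le_total (q - ε / 4) 0 with h | h
      · rw [hr, max_eq_right h]; exact h0
      · rw [hr, max_eq_left h]; exact hlt _ (by linarith)
    have hr0 : 0 ≤ r := le_max_right _ _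
    have hrq : q - ε / 4 ≤ r := le_max_left _ _
    obtain ⟨t, ht, hcov⟩ := Metric.totallyBounded_iff.1 (IsCompact.totallyBounded hrS) (ε / 2) (by positivity)
    refine ⟨t, ht, fun y hy => ?_⟩
    obtain ⟨m, hm, hmy⟩ : ∃ m ∈ closedBall a r, dist m y ≤ ε / 2 := by
      rw [mem_closedBall, dist_comm] at hy
      rcases le_total (dist a y) r with h | h
      · exact ⟨y, by rwa [mem_closedBall, dist_comm], by rw [dist_self]; positivity⟩
      · obtain ⟨m, h1, h2⟩ := ls_point hX a y (ε := ε / 4) (by positivity) hr0 h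
        exact ⟨m, by rw [mem_closedBall, dist_comm, h1], by linarith⟩
    have := hcov hm
    simp only [Set.mem_iUnion, mem_ball] at this ⊢
    obtain ⟨z, hz, hz'⟩ := this
    exact ⟨z, hz, by linarith [dist_triangle y m z, dist_comm y m]⟩
  obtain ⟨η, hη, hcomp⟩ := IsCompact.exists_isCompact_cthickening (show IsCompact (closedBall a q) from hqS)
  have : q + η / 2 ∈ S := by
    refine IsCompact.of_isClosed_subset hcomp isClosed_closedBall fun y hy => ?_
    rw [mem_closedBall, dist_comm] at hy
    rcases le_total (dist a y) q with h | h
    · exact Metric.self_subset_cthickening _ (by rwa [mem_closedBall, dist_comm])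
    · obtain ⟨m, h1, h2⟩ := ls_point hX a y (ε := η / 2) (by positivity) hq0 h
      exact mem_cthickening_of_dist_le y m _ _ (by rw [mem_closedBall, dist_comm, h1])
        (by rw [dist_comm]; linarith)
  have := le_csSup hB this
  linarith

lemma ultralimit {X : Type*} [MetricSpace X] [ProperSpace X] (F : ℕ → ℝ → X) (e : ℕ → ℝ)
    (he : Tendsto e atTop (𝓝 0)) (hF : ∀ n s t, dist (F n s) (F n t) ≤ |s - t| + e n)
    (K : ℝ → Set X) (hK : ∀ t, IsCompact (K t)) (hFK : ∀ n t, F n t ∈ K t) :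
    ∃ f : ℝ → X, LipschitzWith 1 f ∧ ∀ t, Tendsto (fun n => F n t) (hyperfilter ℕ : Filter ℕ) (𝓝 (f t)) := by
  have h : ∀ t, ∃ y, Tendsto (fun n => F n t) (hyperfilter ℕ : Filter ℕ) (𝓝 y) := by
    intro t
    obtain ⟨y, -, hy⟩ := (hK t).ultrafilter_le_nhds ((hyperfilter ℕ).map (fun n => F n t))
      (by simp only [le_principal_iff, Ultrafilter.coe_map, mem_map]; exact Filter.univ_mem' (fun n => hFK n t))
    exact ⟨y, hy⟩
  choose f hf using h
  refine ⟨f, ?_, hf⟩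
  apply LipschitzWith.of_dist_le_mul
  intro s t
  have h1 : Tendsto (fun n => dist (F n s) (F n t)) (hyperfilter ℕ : Filter ℕ) (𝓝 (dist (f s) (f t))) :=
    (hf s).dist (hf t)
  have h2 : Tendsto (fun n => |s - t| + e n) (hyperfilter ℕ : Filter ℕ) (𝓝 (|s - t| + 0)) :=
    tendsto_const_nhds.add (he.mono_left Nat.hyperfilter_le_atTop)
  have := le_of_tendsto_of_tendsto' h1 h2 (fun n => hF n s t)
  simpa [Real.dist_eq] using this

lemma ls_geod {X : Type*} [MetricSpace X] [ProperSpace X] (hX : IsLengthSpace X) (a b : X) :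
    ∃ f : ℝ → X, LipschitzWith 1 f ∧ f 0 = a ∧ ∀ t, dist a b ≤ t → f t = b := by
  set L := dist a b with hL
  have hL0 : 0 ≤ L := dist_nonneg
  have key : ∀ n : ℕ, ∃ G : ℝ → X, (∀ s ∈ Set.Icc 0 L, ∀ t ∈ Set.Icc 0 L,
      dist (G s) (G t) ≤ |s - t| + 1 / ((n : ℝ) + 1)) ∧ G 0 = a ∧ dist (G L) b ≤ 1 / ((n : ℝ) + 1) ∧
      ∀ s ∈ Set.Icc 0 L, dist a (G s) ≤ L := by
    intro n
    obtain ⟨p, hp⟩ := ls_path hX a b (ε := 1 / ((n : ℝ) + 1)) (by positivity)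
    have hc : Continuous (fun t => dist a (p t)) := by fun_prop
    have : ∀ s : ℝ, ∃ t : I, s ∈ Set.Icc 0 L → dist a (p t) = s := by
      intro s
      by_cases hs : s ∈ Set.Icc 0 L
      · obtain ⟨t, ht⟩ : s ∈ Set.range (fun t => dist a (p t)) := by
          apply mem_range_of_exists_le_of_exists_ge hc
          · exact ⟨0, by simpa using hs.1⟩
          · exact ⟨1, by simpa using hs.2⟩
        exact ⟨t, fun _ => ht⟩
      · exact ⟨0, fun h => absurd h hs⟩
    choose τ hτ using this
    have aux : ∀ s ∈ Set.Icc 0 L, ∀ t ∈ Set.Icc 0 L, τ s ≤ τ t →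
        dist (p (τ s)) (p (τ t)) ≤ |s - t| + 1 / ((n : ℝ) + 1) := by
      intro s hs t ht hst
      have h1 := hp _ _ hst
      have h2 := hτ s hs
      have h3 := hτ t ht
      have h4 := dist_triangle a (p (τ t)) b
      have := neg_abs_le (s - t)
      linarith
    refine ⟨fun s => p (τ s), ?_, ?_, ?_, ?_⟩
    · intro s hs t ht
      rcases le_total (τ s) (τ t) with h | h
      · exact aux s hs t ht h
      · rw [dist_comm, abs_sub_comm]; exact aux t ht s hs h
    · exact (dist_eq_zero.1 (hτ 0 ⟨le_rfl, hL0⟩)).symm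
    · have h1 := hp (τ L) (τ L) le_rfl
      have h2 := hτ L ⟨hL0, le_rfl⟩
      simp only [dist_self] at h1
      linarith
    · intro s hs
      rw [hτ s hs]; exact hs.2
  choose G hG1 hG2 hG3 hG4 using key
  let cl : ℝ → ℝ := fun t => max 0 (min t L)
  have hcl : ∀ t, cl t ∈ Set.Icc 0 L := fun t => ⟨le_max_left _ _, max_le hL0 (min_le_right _ _)⟩
  have hcl1 : ∀ s t, |cl s - cl t| ≤ |s - t| := fun s t => by
    simp only [cl]
    grind
  obtain ⟨f, hf, hlim⟩ := ultralimit (fun n t => G n (cl t)) (fun n => 1 / ((n : ℝ) + 1))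
    tendsto_one_div_add_atTop_nhds_zero_nat
    (fun n s t => (hG1 n _ (hcl s) _ (hcl t)).trans (by linarith [hcl1 s t]))
    (fun _ => closedBall a L) (fun _ => isCompact_closedBall a L)
    (fun n t => by rw [mem_closedBall, dist_comm]; exact hG4 n _ (hcl t))
  refine ⟨f, hf, ?_, ?_⟩
  · refine tendsto_nhds_unique (hlim 0) ?_
    have : cl 0 = 0 := by simp [cl, hL0]
    simp only [this, hG2]
    exact tendsto_const_nhds
  · intro t ht
    refine tendsto_nhds_unique (hlim t) ?_
    have : cl t = L := by simp [cl, hL0, ht]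
    simp only [this]
    rw [tendsto_iff_dist_tendsto_zero]
    refine squeeze_zero (fun _ => dist_nonneg) (fun n => hG3 n) ?_
    exact tendsto_one_div_add_atTop_nhds_zero_nat.mono_left Nat.hyperfilter_le_atTop

/-- A groupoid homomorphism from the fundamental groupoid to a group. -/
structure Hol (X : Type*) [TopologicalSpace X] (G : Type*) [Group G] where
  F : ∀ {a b : X}, Path a b → G
  map_trans : ∀ {a b c : X} (p : Path a b) (q : Path b c), F (p.trans q) = F p * F q
  map_htpy : ∀ {a b : X} (p q : Path a b), p.Homotopic q → F p = F q

section
open CategoryTheory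

lemma exists_hol {X : Type*} [TopologicalSpace X] [PathConnectedSpace X] {x : X}
    (N : Subgroup (FundamentalGroup X x)) [N.Normal] :
    ∃ Φ : Hol X (FundamentalGroup X x ⧸ N), ∀ (y : X) (α : Path x y) (β : Path y y),
      Φ.F β = 1 ↔ loopClass α β ∈ N := by
  let A : ∀ y : X, (FundamentalGroupoid.mk x ⟶ FundamentalGroupoid.mk y) :=
    fun y => (⟦PathConnectedSpace.somePath x y⟧ : Path.Homotopic.Quotient x y)
  let m : ∀ {a b : X}, Path a b → (FundamentalGroupoid.mk a ⟶ FundamentalGroupoid.mk b) :=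
    fun p => (⟦p⟧ : Path.Homotopic.Quotient _ _)
  have hm : ∀ {a b c : X} (p : Path a b) (q : Path b c), m (p.trans q) = m p ≫ m q :=
    fun p q => rfl
  have hs : ∀ {a b : X} (p : Path a b), m p.symm = inv (m p) := fun p => by
    rw [← Groupoid.inv_eq_inv]; rfl
  let l : ∀ {a b : X}, Path a b → FundamentalGroup X x :=
    fun {a b} p => (A a ≫ m p ≫ inv (A b))
  have hl : ∀ {a b c : X} (p : Path a b) (q : Path b c), l (p.trans q) = l q * l p := by
    intro a b c p q
    change _ = (A a ≫ m p ≫ inv (A b)) ≫ (A b ≫ m q ≫ inv (A c))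
    simp [l, hm]
  refine ⟨⟨fun p => (QuotientGroup.mk (l p))⁻¹, ?_, ?_⟩, ?_⟩
  · intro a b c p q
    rw [hl, QuotientGroup.mk_mul, mul_inv_rev]
  · intro a b p q h
    have : m p = m q := Quotient.sound h
    simp only [l, this]
  · intro y α β
    simp only [inv_eq_one, QuotientGroup.eq_one_iff]
    let g : FundamentalGroup X x := A y ≫ inv (m α)
    have e : loopClass α β = g * l β * g⁻¹ := by
      rw [eq_mul_inv_iff_mul_eq]
      change (A y ≫ inv (m α)) ≫ ((m α ≫ m β) ≫ m α.symm) = (A y ≫ m β ≫ inv (A y)) ≫ (A y ≫ inv (m α))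
      rw [hs]
      simp
    rw [e]
    exact ((inferInstance : N.Normal).mem_comm_iff.trans (by rw [inv_mul_cancel_left])).symm
end

namespace Hol
variable {X : Type*} [TopologicalSpace X] {G : Type*} [Group G] (Φ : Hol X G)

lemma map_refl (a : X) : Φ.F (Path.refl a) = 1 := by
  have h := Φ.map_trans (Path.refl a) (Path.refl a)
  rw [Path.refl_trans_refl] at h
  exact left_eq_mul.1 h

lemma map_symm {a b : X} (p : Path a b) : Φ.F p.symm = (Φ.F p)⁻¹ := by
  rw [eq_inv_iff_mul_eq_one, ← Φ.map_trans, ← Φ.map_refl b]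
  exact Φ.map_htpy _ _ (Path.Homotopic.symm_trans p)

lemma map_cast {a b a' b' : X} (p : Path a b) (ha : a' = a) (hb : b' = b) :
    Φ.F (p.cast ha hb) = Φ.F p := by
  subst ha hb; rfl
end Hol

/-- The affine path in the line. -/
def lin (s t : ℝ) : Path s t where
  toFun u := s + u * (t - s)
  continuous_toFun := by fun_prop
  source' := by simp
  target' := by simp

/-- Restriction of a continuous map. -/
def sg {X : Type*} [TopologicalSpace X] (f : C(ℝ, X)) (s t : ℝ) : Path (f s) (f t) :=
  (lin s t).map f.continuous

lemma sg_apply {X : Type*} [TopologicalSpace X] (f : C(ℝ, X)) (s t : ℝ) (u : I) :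
    sg f s t u = f (s + u * (t - s)) := rfl

namespace Hol
variable {X : Type*} [TopologicalSpace X] {G : Type*} [Group G] (Φ : Hol X G)

/-- holonomy along a curve -/
def H (f : C(ℝ, X)) (s t : ℝ) : G := Φ.F (sg f s t)

lemma H_mul (f : C(ℝ, X)) (s t r : ℝ) : Φ.H f s t * Φ.H f t r = Φ.H f s r := by
  unfold H
  rw [← Φ.map_trans]
  apply Φ.map_htpy
  unfold sg
  rw [← Path.map_trans]
  exact (SimplyConnectedSpace.paths_homotopic ((lin s t).trans (lin t r)) (lin s r)).map f

lemma H_self (f : C(ℝ, X)) (s : ℝ) : Φ.H f s s = 1 := by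
  have := Φ.H_mul f s s s
  exact mul_eq_left.1 this

lemma H_path {a b : X} (p : Path a b) : Φ.H ⟨p.extend, p.continuous_extend⟩ 0 1 = Φ.F p := by
  unfold H
  rw [← Φ.map_cast p (p.extend_zero) (p.extend_one)]
  congr 1
  ext u
  simp [sg_apply]
end Hol

/-- length-like bound for a path. -/
def W {X : Type*} [MetricSpace X] {a b : X} (p : Path a b) (l : ℝ) : Prop :=
  ∀ t, dist a (p t) + dist (p t) b ≤ l

namespace W
variable {X : Type*} [MetricSpace X]

lemma dist_le {a b : X} {p : Path a b} {l : ℝ} (h : W p l) : dist a b ≤ l := by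
  simpa using h 0

lemma symm {a b : X} {p : Path a b} {l : ℝ} (h : W p l) : W p.symm l := by
  intro t
  have := h (unitInterval.symm t)
  rw [Path.symm_apply, Function.comp_apply, dist_comm b, dist_comm _ a]
  linarith

lemma trans {a b c : X} {p : Path a b} {q : Path b c} {l m : ℝ} (h : W p l) (h' : W q m) :
    W (p.trans q) (l + m) := by
  intro t
  have ht : p.trans q t ∈ Set.range (p.trans q) := ⟨t, rfl⟩
  rw [Path.trans_range] at ht
  generalize p.trans q t = z at ht
  rcases ht with ⟨u, rfl⟩ | ⟨u, rfl⟩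
  · linarith [h u, h'.dist_le, dist_triangle (p u) b c]
  · linarith [h' u, h.dist_le, dist_triangle a b (q u)]

lemma sg {f : C(ℝ, X)} (hf : LipschitzWith 1 f) (s t : ℝ) : W (sg f s t) |s - t| := by
  intro u
  rw [sg_apply]
  have h1 := hf.dist_le_mul s (s + u * (t - s))
  have h2 := hf.dist_le_mul (s + u * (t - s)) t
  rw [Real.dist_eq] at h1 h2
  have e1 : s - (s + u * (t - s)) = u * (s - t) := by ring
  have e2 : (s + u * (t - s)) - t = (1 - u) * (s - t) := by ring
  rw [e1, abs_mul, abs_of_nonneg u.2.1] at h1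
  rw [e2, abs_mul, abs_of_nonneg (by linarith [u.2.2])] at h2
  simp only [NNReal.coe_one, one_mul] at h1 h2
  linarith
end W

section
variable {X : Type*} [MetricSpace X] {G : Type*} [Group G] (Φ : Hol X G) {δ : ℝ}
  (hB : ∀ (y : X) (β : Path y y) (c : X), (∀ t, β t ∈ ball c δ) → Φ.F β = 1)
  (geo : ∀ a b : X, Path a b) (hgeo : ∀ a b, W (geo a b) (dist a b))

include hB

lemma hol_W {a b : X} {p q : Path a b} {l m : ℝ} (hp : W p l) (hq : W q m) (h : l + m < 2 * δ) :
    Φ.F p = Φ.F q := by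
  have h1 := hp.trans hq.symm
  have h2 : Φ.F (p.trans q.symm) = 1 := by
    refine hB _ _ a fun t => ?_
    have := h1 t
    rw [dist_comm] at this
    rw [mem_ball]
    linarith
  rw [Φ.map_trans, Φ.map_symm] at h2
  exact mul_inv_eq_one.1 h2

include hgeo

lemma hol_square {f g : C(ℝ, X)} (hf : LipschitzWith 1 f) (hg : LipschitzWith 1 g) (s t s' t' : ℝ)
    (h : |s - t| + dist (f t) (g t') + (dist (f s) (g s') + |s' - t'|) < 2 * δ) :
    Φ.H f s t * Φ.F (geo (f t) (g t')) = Φ.F (geo (f s) (g s')) * Φ.H g s' t' := by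
  unfold Hol.H
  rw [← Φ.map_trans, ← Φ.map_trans]
  exact hol_W Φ hB ((W.sg hf s t).trans (hgeo _ _)) ((hgeo _ _).trans (W.sg hg s' t')) h

lemma hol_triangle (a b c : X) (h : dist a b + dist b c + dist a c < 2 * δ) :
    Φ.F (geo a b) * Φ.F (geo b c) = Φ.F (geo a c) := by
  rw [← Φ.map_trans]
  exact hol_W Φ hB ((hgeo _ _).trans (hgeo _ _)) (hgeo _ _) h

lemma hol_self (hδ : 0 < δ) (a : X) : Φ.F (geo a a) = 1 := by
  have := hol_triangle Φ hB geo hgeo a a a (by simpa using hδ)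
  exact mul_eq_left.1 this

/-- A loop is trivial if all thin triangles are. -/
lemma hol_fill (hδ : 0 < δ) {y : X} (β : Path y y) (k : X → G) {ε : ℝ} (hε : 0 < ε)
    (hk : ∀ s t : I, dist (β s) (β t) < ε → k (β s) * Φ.F (geo (β s) (β t)) = k (β t)) :
    Φ.F β = 1 := by
  set f : C(ℝ, X) := ⟨β.extend, β.continuous_extend⟩ with hf
  have hk' : ∀ s t : ℝ, dist (f s) (f t) < ε → k (f s) * Φ.F (geo (f s) (f t)) = k (f t) :=
    fun s t h => hk (Set.projIcc 0 1 zero_le_one s) (Set.projIcc 0 1 zero_le_one t) h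
  have hloc : IsLocallyConstant (fun t => Φ.H f 0 t * (k (f t))⁻¹) := by
    rw [IsLocallyConstant.iff_eventually_eq]
    intro t
    have hcont := Metric.continuousAt_iff.1 (f.continuous.continuousAt (x := t)) (min ε (δ / 2)) (by positivity)
    obtain ⟨η, hη, hcl⟩ := hcont
    refine Metric.eventually_nhds_iff.2 ⟨η, hη, fun s hs => ?_⟩
    have hW : W (sg f t s) (3 * δ / 2) := by
      intro u
      rw [sg_apply]
      have h1 : dist (t + u * (s - t)) t < η := by
        rw [Real.dist_eq] at hs ⊢
        rw [add_sub_cancel_left, abs_mul, abs_of_nonneg u.2.1]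
        exact (mul_le_of_le_one_left (abs_nonneg _) u.2.2).trans_lt hs
      have h2 := (hcl h1).trans_le (min_le_right _ _)
      have h3 := (hcl hs).trans_le (min_le_right _ _)
      rw [dist_comm] at h2
      have h4 := dist_triangle_left (f (t + u * (s - t))) (f s) (f t)
      rw [dist_comm (f s) (f t)] at h3
      linarith
    have e : Φ.H f t s = Φ.F (geo (f t) (f s)) := by
      refine hol_W Φ hB hW (hgeo _ _) ?_
      have h3 := (hcl hs).trans_le (min_le_right _ _)
      rw [dist_comm] at h3
      linarith
    rw [← Φ.H_mul f 0 t s, e, ← hk' t s]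
    · group
    · rw [dist_comm]; exact (hcl hs).trans_le (min_le_left _ _)
  have := hloc.apply_eq_of_preconnectedSpace 0 1
  simp only [Φ.H_self] at this
  have h0 : f 0 = y := β.extend_zero
  have h1 : f 1 = y := β.extend_one
  rw [h0, h1, hf, Φ.H_path, mul_left_inj] at this
  exact this.symm
end
/-- In a complete locally compact length space, if
`δ ∈ CovSpec^R_cut(X,x)` then `2δ` is in the length spectrum: there is a closed
geodesic of length `2δ`, i.e. a `2δ`-periodic continuous map `γ : ℝ → X` with
`dist (γ s) (γ t) = |s - t|` whenever `|s - t| ≤ δ`. -/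
theorem cutCovSpec_subset_half_lengthSpectrum
    {X : Type*} [MetricSpace X] [CompleteSpace X] [LocallyCompactSpace X]
    (hX : IsLengthSpace X) (x : X) (R δ : ℝ) (hR : 0 < R)
    (hδ : δ ∈ cutCovSpec X x R) :
    ∃ γ : ℝ → X, Continuous γ ∧ Function.Periodic γ (2 * δ) ∧
      ∀ s t : ℝ, |s - t| ≤ δ → dist (γ s) (γ t) = |s - t| := by
  obtain ⟨hδ0, hne⟩ := hδ
  have := ls_proper hX
  have : PathConnectedSpace X := ⟨⟨x⟩, fun a b => ⟨(ls_path hX a b one_pos).choose⟩⟩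
  obtain ⟨Φ, hΦ⟩ := exists_hol (cutCoveringGroup X x δ R)
  have hB : ∀ (y : X) (β : Path y y) (c : X), (∀ t, β t ∈ ball c δ) → Φ.F β = 1 := by
    intro y β c h
    rw [hΦ y (PathConnectedSpace.somePath x y)]
    exact Subgroup.subset_normalClosure ⟨y, β, _, Or.inl ⟨c, h⟩, rfl⟩
  have hgd : ∀ a b : X, ∃ f : C(ℝ, X), LipschitzWith 1 f ∧ f 0 = a ∧ ∀ t, dist a b ≤ t → f t = b := by
    intro a b
    obtain ⟨f, h1, h2, h3⟩ := ls_geod hX a b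
    exact ⟨⟨f, h1.continuous⟩, h1, h2, h3⟩
  choose gd hgd1 hgd2 hgd3 using hgd
  let geo : ∀ a b : X, Path a b := fun a b =>
    (sg (gd a b) 0 (dist a b)).cast (hgd2 a b).symm (hgd3 a b _ le_rfl).symm
  have hgeo : ∀ a b, W (geo a b) (dist a b) := by
    intro a b t
    have := W.sg (hgd1 a b) 0 (dist a b) t
    rw [sg_apply, hgd2, hgd3 a b _ le_rfl, zero_sub, abs_neg, abs_of_nonneg dist_nonneg] at this
    exact this
  clear_value geo
  -- bad loops
  have hbad : ∀ δ' > δ, ∃ (y : X) (β : Path y y) (c : X), (∀ t, β t ∈ ball c δ') ∧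
      (∃ t, β t ∈ closedBall x R) ∧ Φ.F β ≠ 1 := by
    intro δ' hδ'
    by_contra hcon
    push Not at hcon
    apply hne δ' hδ'
    apply le_antisymm
    · apply Subgroup.normalClosure_le_normal
      rintro g ⟨y, β, α, h | h, rfl⟩
      · by_cases hout : ∃ t, β t ∈ closedBall x R
        · obtain ⟨c, hc⟩ := h
          exact (hΦ y α β).1 (hcon y β c hc hout)
        · push Not at hout
          exact Subgroup.subset_normalClosure ⟨y, β, α, Or.inr hout, rfl⟩
      · exact Subgroup.subset_normalClosure ⟨y, β, α, Or.inr h, rfl⟩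
    · apply Subgroup.normalClosure_mono
      rintro g ⟨y, β, α, h, rfl⟩
      refine ⟨y, β, α, h.imp (fun ⟨c, hc⟩ => ⟨c, fun t => ball_subset_ball hδ'.le (hc t)⟩) id, rfl⟩
  -- thin triangles
  have htri : ∀ n : ℕ, ∃ f g : C(ℝ, X), LipschitzWith 1 f ∧ LipschitzWith 1 g ∧ f 0 = g 0 ∧
      dist (f 0) x ≤ R + δ + 1 ∧
      dist (f (δ + 1 / ((n : ℝ) + 1))) (g (δ + 1 / ((n : ℝ) + 1))) < 1 / ((n : ℝ) + 1) ∧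
      Φ.H f 0 (δ + 1 / ((n : ℝ) + 1)) * Φ.F (geo (f (δ + 1 / ((n : ℝ) + 1))) (g (δ + 1 / ((n : ℝ) + 1))))
        ≠ Φ.H g 0 (δ + 1 / ((n : ℝ) + 1)) := by
    intro n
    have hn : 0 < 1 / ((n : ℝ) + 1) := by positivity
    have hn1 : 1 / ((n : ℝ) + 1) ≤ 1 := by
      rw [div_le_one (by positivity)]; linarith [(Nat.cast_nonneg n : (0 : ℝ) ≤ n)]
    set e := 1 / ((n : ℝ) + 1) with he
    obtain ⟨y, β, c, hc, ⟨t0, ht0⟩, hnt⟩ := hbad (δ + e) (by linarith)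
    by_contra hcon
    push Not at hcon
    apply hnt
    refine hol_fill Φ hB geo hgeo hδ0 β (fun z => Φ.H (gd c z) 0 (δ + e)) hn ?_
    intro s t hst
    have hs : gd c (β s) (δ + e) = β s := hgd3 _ _ _ (by rw [dist_comm]; exact (hc s).le)
    have ht : gd c (β t) (δ + e) = β t := hgd3 _ _ _ (by rw [dist_comm]; exact (hc t).le)
    have := hcon (gd c (β s)) (gd c (β t)) (hgd1 _ _) (hgd1 _ _) (by rw [hgd2, hgd2])
      (by
        rw [hgd2]
        have h1 := (mem_ball.1 (hc t0)).le
        rw [mem_closedBall] at ht0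
        rw [dist_comm] at h1
        linarith [dist_triangle c (β t0) x]) (by rw [hs, ht]; exact hst)
    rw [hs, ht] at this
    exact this
  choose F Gn hF hG hFG hx hd hnt using htri
  have hlim0 : Tendsto (fun n : ℕ => 1 / ((n : ℝ) + 1)) (hyperfilter ℕ : Filter ℕ) (𝓝 0) :=
    tendsto_one_div_add_atTop_nhds_zero_nat.mono_left Nat.hyperfilter_le_atTop
  have hul : ∀ F : ℕ → C(ℝ, X), (∀ n, LipschitzWith 1 (F n)) → (∀ n, dist (F n 0) x ≤ R + δ + 1) →
      ∃ f : C(ℝ, X), LipschitzWith 1 f ∧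
        ∀ t, Tendsto (fun n => F n t) (hyperfilter ℕ : Filter ℕ) (𝓝 (f t)) := by
    intro F hF hx
    obtain ⟨f, h1, h2⟩ := ultralimit (fun n => F n) (fun _ => 0) tendsto_const_nhds
      (fun n s t => by simpa [Real.dist_eq] using (hF n).dist_le_mul s t)
      (fun t => closedBall x (R + δ + 1 + |t|)) (fun t => isCompact_closedBall _ _)
      (fun n t => by
        have h1 := (hF n).dist_le_mul t 0
        simp only [Real.dist_eq, sub_zero, NNReal.coe_one, one_mul] at h1
        rw [mem_closedBall]
        linarith [dist_triangle (F n t) (F n 0) x, hx n])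
    exact ⟨⟨f, h1.continuous⟩, h1, h2⟩
  obtain ⟨f, hf, hFf⟩ := hul F hF hx
  obtain ⟨g, hg, hGg⟩ := hul Gn hG (fun n => by rw [← hFG]; exact hx n)
  have hend : ∀ (F : ℕ → C(ℝ, X)) (f : C(ℝ, X)), (∀ n, LipschitzWith 1 (F n)) →
      (∀ t, Tendsto (fun n => F n t) (hyperfilter ℕ : Filter ℕ) (𝓝 (f t))) →
      Tendsto (fun n : ℕ => F n (δ + 1 / ((n : ℝ) + 1))) (hyperfilter ℕ : Filter ℕ) (𝓝 (f δ)) := by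
    intro F f hF hFf
    refine (tendsto_iff_of_dist ?_).1 (hFf δ)
    refine squeeze_zero (fun _ => dist_nonneg) (fun n => ?_) hlim0
    have h1 := (hF n).dist_le_mul δ (δ + 1 / ((n : ℝ) + 1))
    have hn : 0 < 1 / ((n : ℝ) + 1) := by positivity
    rw [Real.dist_eq, sub_add_cancel_left, abs_neg, abs_of_pos hn] at h1
    simpa using h1
  have hFe := hend F f hF hFf
  have hGe := hend Gn g hG hGg
  have h00 : f 0 = g 0 := by
    refine tendsto_nhds_unique (hFf 0) ?_
    simp only [hFG]
    exact hGg 0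
  have h11 : f δ = g δ := by
    refine tendsto_nhds_unique hFe ((tendsto_iff_of_dist ?_).2 hGe)
    exact squeeze_zero (fun _ => dist_nonneg) (fun n => (hd n).le) hlim0
  -- ladder
  have hlad : ∀ (F : ℕ → C(ℝ, X)) (f : C(ℝ, X)), (∀ n, LipschitzWith 1 (F n)) → LipschitzWith 1 f →
      (∀ t, Tendsto (fun n => F n t) (hyperfilter ℕ : Filter ℕ) (𝓝 (f t))) →
      ∀ᶠ n : ℕ in (hyperfilter ℕ : Filter ℕ),
        Φ.H f 0 δ * Φ.F (geo (f δ) (F n (δ + 1 / ((n : ℝ) + 1)))) =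
          Φ.F (geo (f 0) (F n 0)) * Φ.H (F n) 0 (δ + 1 / ((n : ℝ) + 1)) := by
    intro F f hF hf hFf
    have e0 := Metric.tendsto_nhds.1 (hFf 0) (δ / 8) (by positivity)
    have e1 := Metric.tendsto_nhds.1 (hFf (δ / 2)) (δ / 8) (by positivity)
    have e2 := Metric.tendsto_nhds.1 (hend F f hF hFf) (δ / 8) (by positivity)
    have e3 := hlim0.eventually_lt_const (show 0 < δ / 8 by positivity)
    filter_upwards [e0, e1, e2, e3] with n e0 e1 e2 e3
    rw [dist_comm] at e0 e1 e2
    have hn : 0 < 1 / ((n : ℝ) + 1) := by positivity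
    have a1 : |0 - δ / 2| = δ / 2 := by rw [zero_sub, abs_neg, abs_of_pos (by positivity)]
    have a2 : |δ / 2 - δ| = δ / 2 := by rw [abs_sub_comm, abs_of_pos (by linarith)]; ring
    have a3 : |δ / 2 - (δ + 1 / ((n : ℝ) + 1))| = δ / 2 + 1 / ((n : ℝ) + 1) := by
      rw [abs_sub_comm, abs_of_pos (by linarith)]; ring
    have s1 := hol_square Φ hB geo hgeo hf (hF n) 0 (δ / 2) 0 (δ / 2) (by rw [a1]; linarith)
    have s2 := hol_square Φ hB geo hgeo hf (hF n) (δ / 2) δ (δ / 2) (δ + 1 / ((n : ℝ) + 1))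
      (by rw [a2, a3]; linarith)
    rw [← Φ.H_mul f 0 (δ / 2) δ, mul_assoc, s2, ← mul_assoc, s1, mul_assoc, Φ.H_mul]
  have hHne : Φ.H f 0 δ ≠ Φ.H g 0 δ := by
    intro heq
    have e1 := Metric.tendsto_nhds.1 hFe (δ / 2) (by positivity)
    have e2 := Metric.tendsto_nhds.1 hGe (δ / 2) (by positivity)
    have e3 := hlim0.eventually_lt_const (show 0 < δ / 2 by positivity)
    obtain ⟨n, l1, l2, e1, e2, e3⟩ := ((hlad F f hF hf hFf).and ((hlad Gn g hG hg hGg).and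
      (e1.and (e2.and e3)))).exists
    apply hnt n
    have t1 := hol_triangle Φ hB geo hgeo (f δ) (F n (δ + 1 / ((n : ℝ) + 1)))
      (Gn n (δ + 1 / ((n : ℝ) + 1))) (by
        rw [← h11] at e2
        rw [dist_comm] at e1 e2
        linarith [hd n])
    rw [← h00, ← h11, ← heq, ← hFG n, ← t1, ← mul_assoc, l1, mul_assoc, mul_right_inj] at l2
    exact l2
  -- splitting
  have hlow : ∀ s ∈ Set.Icc 0 δ, ∀ t ∈ Set.Icc 0 δ,
      min (s + t) (2 * δ - (s + t)) ≤ dist (f s) (g t) := by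
    intro s hs t ht
    by_contra hcon
    push Not at hcon
    obtain ⟨c1, c2⟩ := lt_min_iff.1 hcon
    apply hHne
    have s1 := hol_square Φ hB geo hgeo hf hg 0 s 0 t (by
      rw [h00, dist_self, zero_sub, zero_sub, abs_neg, abs_neg, abs_of_nonneg hs.1, abs_of_nonneg ht.1]
      linarith)
    have s2 := hol_square Φ hB geo hgeo hf hg s δ t δ (by
      rw [h11, dist_self, abs_sub_comm s, abs_sub_comm t, abs_of_nonneg (sub_nonneg.2 hs.2),
        abs_of_nonneg (sub_nonneg.2 ht.2)]
      linarith)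
    rw [h00, hol_self Φ hB geo hgeo hδ0, one_mul] at s1
    rw [h11, hol_self Φ hB geo hgeo hδ0, mul_one] at s2
    rw [← Φ.H_mul f 0 s δ, s2, ← mul_assoc, s1, Φ.H_mul]
  have hlip : ∀ f : C(ℝ, X), LipschitzWith 1 f → ∀ s t, dist (f s) (f t) ≤ |s - t| := fun f hf s t => by
    simpa [Real.dist_eq] using hf.dist_le_mul s t
  have hiso : ∀ f : C(ℝ, X), LipschitzWith 1 f → δ ≤ dist (f 0) (f δ) → ∀ s ∈ Set.Icc 0 δ,
      ∀ t ∈ Set.Icc 0 δ, dist (f s) (f t) = |s - t| := by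
    intro f hf hfd
    have aux : ∀ s ∈ Set.Icc 0 δ, ∀ t ∈ Set.Icc 0 δ, s ≤ t → dist (f s) (f t) = |s - t| := by
      intro s hs t ht hst
      apply le_antisymm (hlip f hf s t)
      have h1 := hlip f hf 0 s
      have h2 := hlip f hf t δ
      rw [zero_sub, abs_neg, abs_of_nonneg hs.1] at h1
      rw [abs_sub_comm, abs_of_nonneg (sub_nonneg.2 ht.2)] at h2
      rw [abs_sub_comm, abs_of_nonneg (sub_nonneg.2 hst)]
      linarith [dist_triangle4 (f 0) (f s) (f t) (f δ)]
    intro s hs t ht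
    rcases le_total s t with h | h
    · exact aux s hs t ht h
    · rw [dist_comm, abs_sub_comm]; exact aux t ht s hs h
  have hm0 : (0 : ℝ) ∈ Set.Icc 0 δ := ⟨le_rfl, hδ0.le⟩
  have hm1 : δ ∈ Set.Icc 0 δ := ⟨hδ0.le, le_rfl⟩
  have hd0 : δ ≤ dist (f 0) (g δ) := by
    have := hlow 0 hm0 δ hm1
    rw [zero_add, show 2 * δ - δ = δ by ring, min_self] at this
    exact this
  have hfi := hiso f hf (by rw [h11]; exact hd0)
  have hgi := hiso g hg (by rw [← h00]; exact hd0)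
  have hfg : ∀ s ∈ Set.Icc 0 δ, ∀ t ∈ Set.Icc 0 δ,
      dist (f s) (g t) = min (s + t) (2 * δ - (s + t)) := by
    intro s hs t ht
    refine le_antisymm (le_min ?_ ?_) (hlow s hs t ht)
    · have h1 := hfi s hs 0 hm0
      have h2 := hgi 0 hm0 t ht
      rw [sub_zero, abs_of_nonneg hs.1] at h1
      rw [zero_sub, abs_neg, abs_of_nonneg ht.1] at h2
      have := dist_triangle (f s) (f 0) (g t)
      rw [h1, h00, h2] at this
      exact this
    · have h1 := hfi s hs δ hm1
      have h2 := hgi δ hm1 t ht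
      rw [abs_sub_comm, abs_of_nonneg (sub_nonneg.2 hs.2)] at h1
      rw [abs_of_nonneg (sub_nonneg.2 ht.2)] at h2
      have := dist_triangle (f s) (f δ) (g t)
      rw [h1, h11, h2] at this
      linarith
  let E : ℝ → X := fun v => if 0 ≤ v then f v else g (-v)
  have hE : ∀ v ∈ Set.Icc (-δ) δ, ∀ w ∈ Set.Icc (-δ) δ,
      dist (E v) (E w) = min |v - w| (2 * δ - |v - w|) := by
    rintro v ⟨hv1, hv2⟩ w ⟨hw1, hw2⟩
    simp only [E]
    split_ifs with h1 h2 h2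
    · rw [hfi v ⟨h1, hv2⟩ w ⟨h2, hw2⟩, min_eq_left]
      grind
    · rw [hfg v ⟨h1, hv2⟩ (-w) ⟨by linarith, by linarith⟩, abs_of_nonneg (by linarith), sub_eq_add_neg v w]
    · rw [dist_comm, hfg w ⟨h2, hw2⟩ (-v) ⟨by linarith, by linarith⟩, abs_sub_comm,
        abs_of_nonneg (by linarith), sub_eq_add_neg w v]
    · rw [hgi (-v) ⟨by linarith, by linarith⟩ (-w) ⟨by linarith, by linarith⟩, min_eq_left]
      · grind
      · grind
  let r : ℝ → ℝ := fun u => u - 2 * δ * round (u / (2 * δ))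
  have hr : ∀ u, r u ∈ Set.Icc (-δ) δ := by
    intro u
    have h1 := abs_sub_round (u / (2 * δ))
    have h2 : r u = 2 * δ * (u / (2 * δ) - round (u / (2 * δ))) := by
      simp only [r]; field_simp
    rw [abs_le] at h1
    rw [h2]
    constructor <;> nlinarith [h1.1, h1.2]
  have hmain : ∀ s t : ℝ, |s - t| ≤ δ → dist (E (r s)) (E (r t)) = |s - t| := by
    intro s t hst
    rw [hE _ (hr s) _ (hr t)]
    have hs := hr s
    have ht := hr t
    obtain ⟨k, hk⟩ : ∃ k : ℤ, r s - r t = s - t + 2 * δ * k :=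
      ⟨round (t / (2 * δ)) - round (s / (2 * δ)), by simp only [r]; push_cast; ring⟩
    have hst' := abs_le.1 hst
    have k1 : (k : ℝ) < 2 := by
      by_contra h
      push Not at h
      nlinarith [hs.1, hs.2, ht.1, ht.2]
    have k2 : (-2 : ℝ) < k := by
      by_contra h
      push Not at h
      nlinarith [hs.1, hs.2, ht.1, ht.2]
    have k1' : k < 2 := by exact_mod_cast k1
    have k2' : -2 < k := by exact_mod_cast k2
    have hsb := hs.1
    have hsb' := hs.2
    have htb := ht.1
    have htb' := ht.2
    generalize r s = v at *
    generalize r t = w at *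
    interval_cases k
    · norm_num at hk
      rw [abs_of_nonpos (by linarith), min_eq_right (by linarith), abs_of_nonneg (by linarith)]
      linarith
    · norm_num at hk
      rw [hk, min_eq_left]
      linarith
    · norm_num at hk
      rw [abs_of_nonneg (by linarith), min_eq_right (by linarith), abs_of_nonpos (by linarith)]
      linarith
  refine ⟨fun u => E (r u), ?_, ?_, hmain⟩
  · rw [Metric.continuous_iff]
    intro b ε hε
    refine ⟨min ε δ, by positivity, fun a ha => ?_⟩
    rw [Real.dist_eq] at ha
    rw [hmain a b (ha.le.trans (min_le_right _ _))]
    exact ha.trans_le (min_le_left _ _)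
  · intro u
    have : r (u + 2 * δ) = r u := by
      simp only [r]
      rw [add_div, div_self (by positivity), round_add_one]
      push_cast; ring
    simp only [this]
end

section
/- Let X and Y be path-connected metric spaces with basepoints x and y, let D > 0, R > 0, and r > 3(R + 2D). Suppose there is an isometry between the open balls B(x,r) ⊆ X and B(y,r) ⊆ Y (each with the restricted metric) carrying x to y. Then CovSpec^R_cut(X,x) ∩ (0,D] = CovSpec^R_cut(Y,y) ∩ (0,D]. -/
/- Common definitions: path length, length/geodesic spaces, δ-covering groups,
   covering spectra, cut-off covering groups and spectra, free homotopy,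
   loops-to-infinity. -/

open Metric Filter
open scoped NNReal ENNReal unitInterval

attribute [local instance] Path.Homotopic.setoid

section VK
variable {X : Type*} [TopologicalSpace X] {G : Type*} [Group G]

/-- Straight segment through a planar map. -/
noncomputable def seg2 (F : C(ℝ × ℝ, X)) (p q : ℝ × ℝ) : C(I, X) :=
  ⟨fun t => F (AffineMap.lineMap p q (t : ℝ)), by fun_prop⟩

/-- Restriction of a curve to an interval. -/
noncomputable def seg1 (f : C(ℝ, X)) (s t : ℝ) : C(I, X) :=
  ⟨fun τ => f (AffineMap.lineMap s t (τ : ℝ)), by fun_prop⟩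

/-- Local cocycles on curves. -/
structure Coc (U V : Set X) (φ : C(I, X) → G) : Prop where
  oU : IsOpen U
  oV : IsOpen V
  cov : ∀ x, x ∈ U ∨ x ∈ V
  coc : ∀ (F : C(ℝ × ℝ, X)) (p q s : ℝ × ℝ),
    ((∀ z ∈ convexHull ℝ {p, q, s}, F z ∈ U) ∨ (∀ z ∈ convexHull ℝ {p, q, s}, F z ∈ V)) →
    φ (seg2 F p q) * φ (seg2 F q s) = φ (seg2 F p s)

variable {U V : Set X} {φ : C(I, X) → G}

theorem Coc.prim2 (h : Coc U V φ) (F : C(ℝ × ℝ, X)) :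
    ∃ u : ℝ × ℝ → G, ∃ ε > 0, ∀ p q : ℝ × ℝ, ‖p‖ ≤ 1 → ‖q‖ ≤ 1 → dist p q < ε →
      u q = u p * φ (seg2 F p q) := by
  obtain ⟨ε, hε, hb⟩ := lebesgue_number_lemma_of_metric (s := Metric.closedBall (0 : ℝ × ℝ) 1)
    (c := fun b : Bool => if b then F ⁻¹' U else F ⁻¹' V) (isCompact_closedBall _ _)
    (by
      intro b
      cases b
      · simpa using h.oV.preimage F.continuous
      · simpa using h.oU.preimage F.continuous)
    (by
      intro z _
      rcases h.cov (F z) with hz | hz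
      · exact Set.mem_iUnion.2 ⟨true, by simpa using hz⟩
      · exact Set.mem_iUnion.2 ⟨false, by simpa using hz⟩)
  have key : ∀ p q s : ℝ × ℝ, ‖p‖ ≤ 1 → dist q p < ε → dist s p < ε →
      φ (seg2 F p q) * φ (seg2 F q s) = φ (seg2 F p s) := by
    intro p q s hp hq hs
    apply h.coc
    have hsub : convexHull ℝ {p, q, s} ⊆ Metric.ball p ε := by
      apply convexHull_min _ (convex_ball p ε)
      intro z hz
      rcases hz with rfl | rfl | rfl
      · simpa using hε
      · exact hq
      · exact hs
    obtain ⟨b, hb⟩ := hb p (by simpa using hp)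
    cases b
    · right
      intro z hz
      simpa using hb (hsub hz)
    · left
      intro z hz
      simpa using hb (hsub hz)
  obtain ⟨n, hn⟩ := exists_nat_gt (2 / ε)
  have hn0 : (0 : ℝ) < n := lt_trans (by positivity) hn
  have hn1 : 1 / (n : ℝ) < ε / 2 := by
    rw [div_lt_iff₀ hε] at hn
    rw [div_lt_iff₀ hn0]
    linarith
  let w : ℕ → ℝ × ℝ → G := fun k p =>
    Nat.rec (1 : G) (fun k g => g * φ (seg2 F (((k : ℝ) / n) • p) (((k + 1 : ℕ) / n : ℝ) • p))) k
  refine ⟨w n, ε / 2, by positivity, ?_⟩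
  intro p q hp hq hpq
  have step : ∀ k : ℕ, k ≤ n → w k q = w k p * φ (seg2 F (((k : ℝ) / n) • p) (((k : ℝ) / n) • q)) := by
    intro k
    induction k with
    | zero =>
      intro _
      have := key 0 0 0 (by simp) (by simpa using hε) (by simpa using hε)
      have h1 : φ (seg2 F 0 0) = 1 := by simpa using this
      simp [w, h1]
    | succ k ih =>
      intro hk
      have ih := ih (by omega)
      have e1 : ∀ z, w (k + 1) z = w k z * φ (seg2 F (((k : ℝ) / n) • z) (((k + 1 : ℕ) / n : ℝ) • z)) :=
        fun z => rfl
      have hk' : ((k : ℝ) + 1) ≤ n := by exact_mod_cast hk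
      have a0 : (0 : ℝ) ≤ (k : ℝ) / n := by positivity
      have a1 : (k : ℝ) / n ≤ 1 := by rw [div_le_one hn0]; linarith
      have b0 : (0 : ℝ) ≤ ((k + 1 : ℕ) : ℝ) / n := by positivity
      have b1 : ((k + 1 : ℕ) : ℝ) / n ≤ 1 := by rw [div_le_one hn0]; push_cast; linarith
      have hab : ((k + 1 : ℕ) : ℝ) / n - (k : ℝ) / n = 1 / n := by push_cast; ring
      set a : ℝ := (k : ℝ) / n
      set b : ℝ := ((k + 1 : ℕ) : ℝ) / n
      have hap : ‖a • p‖ ≤ 1 := by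
        rw [norm_smul, Real.norm_of_nonneg a0]; nlinarith [norm_nonneg p]
      have d1 : dist (a • q) (a • p) < ε / 2 := by
        rw [dist_eq_norm, ← smul_sub, norm_smul, Real.norm_of_nonneg a0]
        rw [dist_comm, dist_eq_norm] at hpq
        nlinarith [norm_nonneg (q - p)]
      have d2 : dist (b • q) (b • p) < ε / 2 := by
        rw [dist_eq_norm, ← smul_sub, norm_smul, Real.norm_of_nonneg b0]
        rw [dist_comm, dist_eq_norm] at hpq
        nlinarith [norm_nonneg (q - p)]
      have d3 : dist (b • p) (a • p) < ε / 2 := by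
        rw [dist_eq_norm, ← sub_smul, norm_smul, hab, Real.norm_of_nonneg (by positivity)]
        have : 0 ≤ 1 / (n : ℝ) := by positivity
        nlinarith [norm_nonneg p]
      have d4 : dist (b • q) (a • p) < ε :=
        lt_of_le_of_lt (dist_triangle _ (b • p) _) (by linarith)
      rw [e1 q, e1 p, ih, mul_assoc, mul_assoc, key _ _ _ hap (by linarith) d4,
        key _ _ _ hap (by linarith) d4]
  have hs := step n le_rfl
  have hnn : (n : ℝ) / n = 1 := div_self hn0.ne'
  simpa [hnn] using hs

/-- Primitive of the cocycle along a curve. -/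
def Prim (φ : C(I, X) → G) (f : C(ℝ, X)) (u : ℝ → G) : Prop :=
  ∃ ε > 0, ∀ s t : ℝ, s ∈ Set.Icc (0 : ℝ) 1 → t ∈ Set.Icc (0 : ℝ) 1 → dist s t < ε →
    u t = u s * φ (seg1 f s t)

theorem Coc.prim1 (h : Coc U V φ) (f : C(ℝ, X)) : ∃ u, Prim φ f u := by
  obtain ⟨u, ε, hε, hu⟩ := h.prim2 (f.comp ⟨Prod.fst, continuous_fst⟩)
  refine ⟨fun s => u (s, 0), ε, hε, fun s t hs ht hst => ?_⟩
  beta_reduce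
  have := hu (s, 0) (t, 0)
    (by simpa [Prod.norm_def, abs_le] using ⟨by linarith [hs.1], hs.2⟩)
    (by simpa [Prod.norm_def, abs_le] using ⟨by linarith [ht.1], ht.2⟩)
    (by simpa [Prod.dist_eq, hε] using hst)
  rw [this]
  congr 2

theorem Prim.unique {f : C(ℝ, X)} {u v : ℝ → G} (hu : Prim φ f u) (hv : Prim φ f v) :
    (u 0)⁻¹ * u 1 = (v 0)⁻¹ * v 1 := by
  obtain ⟨ε, hε, hu⟩ := hu
  obtain ⟨ε', hε', hv⟩ := hv
  have hc : IsLocallyConstant (fun s : I => u s * (v s)⁻¹) := by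
    rw [IsLocallyConstant.iff_eventually_eq]
    intro s
    filter_upwards [Metric.ball_mem_nhds s (lt_min hε hε')] with t ht
    have ht' : dist (s : ℝ) t < min ε ε' := by
      rw [dist_comm]; exact ht
    rw [hu s t s.2 t.2 (lt_of_lt_of_le ht' (min_le_left _ _)),
      hv s t s.2 t.2 (lt_of_lt_of_le ht' (min_le_right _ _))]
    group
  have := hc.apply_eq_of_preconnectedSpace 0 1
  simp only [Set.Icc.coe_zero, Set.Icc.coe_one] at this
  have h2 : u 1 = u 0 * (v 0)⁻¹ * v 1 := by rw [this]; group
  rw [h2]; group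

/-- Extension of a path as a continuous map. -/
noncomputable def ext1 {a b : X} (γ : Path a b) : C(ℝ, X) := ⟨γ.extend, γ.continuous_extend⟩

open Classical in
/-- Total value of the cocycle along a path. -/
noncomputable def val (φ : C(I, X) → G) {a b : X} (γ : Path a b) : G :=
  if h : ∃ u, Prim φ (ext1 γ) u then (h.choose 0)⁻¹ * h.choose 1 else 1

theorem val_eq {a b : X} {γ : Path a b} {u : ℝ → G} (hu : Prim φ (ext1 γ) u) :
    val φ γ = (u 0)⁻¹ * u 1 := by
  have h : ∃ u, Prim φ (ext1 γ) u := ⟨u, hu⟩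
  rw [val, dif_pos h]
  exact h.choose_spec.unique hu

theorem Coc.val_trans (h : Coc U V φ) {a b c : X} (γ : Path a b) (η : Path b c) :
    val φ (γ.trans η) = val φ γ * val φ η := by
  obtain ⟨u, hu⟩ := h.prim1 (ext1 (γ.trans η))
  have h1 : Prim φ (ext1 γ) (fun s => u (s / 2)) := by
    obtain ⟨ε, hε, hu⟩ := hu
    refine ⟨ε, hε, fun s t hs ht hst => ?_⟩
    beta_reduce
    rw [hu (s / 2) (t / 2) ⟨by linarith [hs.1], by linarith [hs.2]⟩
      ⟨by linarith [ht.1], by linarith [ht.2]⟩ ?_]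
    · congr 2
      ext τ
      have hm : AffineMap.lineMap s t (τ : ℝ) ∈ Set.Icc (0 : ℝ) 1 :=
        (convex_Icc (0 : ℝ) 1).lineMap_mem hs ht τ.2
      have e : AffineMap.lineMap (s / 2) (t / 2) (τ : ℝ) = (AffineMap.lineMap s t (τ : ℝ) : ℝ) / 2 := by
        simp [AffineMap.lineMap_apply]; ring
      simp only [seg1, ext1, ContinuousMap.coe_mk, e]
      set z : ℝ := AffineMap.lineMap s t (τ : ℝ)
      rw [Path.extend_apply _ (t := z / 2) ⟨by linarith [hm.1], by linarith [hm.2]⟩, Path.trans_apply,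
        dif_pos (by show z / 2 ≤ 1 / 2; linarith [hm.2]), Path.extend_apply _ hm]
      congr 1
      ext
      show 2 * (z / 2) = z
      ring
    · rw [Real.dist_eq, ← sub_div, abs_div, abs_two]
      rw [Real.dist_eq] at hst
      linarith [abs_nonneg (s - t)]
  have h2 : Prim φ (ext1 η) (fun s => u ((s + 1) / 2)) := by
    obtain ⟨ε, hε, hu⟩ := hu
    refine ⟨ε, hε, fun s t hs ht hst => ?_⟩
    beta_reduce
    rw [hu ((s + 1) / 2) ((t + 1) / 2) ⟨by linarith [hs.1], by linarith [hs.2]⟩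
      ⟨by linarith [ht.1], by linarith [ht.2]⟩ ?_]
    · congr 2
      ext τ
      have hm : AffineMap.lineMap s t (τ : ℝ) ∈ Set.Icc (0 : ℝ) 1 :=
        (convex_Icc (0 : ℝ) 1).lineMap_mem hs ht τ.2
      have e : AffineMap.lineMap ((s + 1) / 2) ((t + 1) / 2) (τ : ℝ)
          = ((AffineMap.lineMap s t (τ : ℝ) : ℝ) + 1) / 2 := by
        simp [AffineMap.lineMap_apply]; ring
      simp only [seg1, ext1, ContinuousMap.coe_mk, e]
      set z : ℝ := AffineMap.lineMap s t (τ : ℝ)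
      have hz : (z + 1) / 2 ∈ Set.Icc (0 : ℝ) 1 := ⟨by linarith [hm.1], by linarith [hm.2]⟩
      rw [Path.extend_apply _ hz, Path.extend_apply _ hm, Path.trans_apply]
      split_ifs with hh
      · have hz0 : z = 0 := by
          have : (z + 1) / 2 ≤ 1 / 2 := hh
          linarith [hm.1]
        have e1 : η ⟨z, hm⟩ = b := by
          refine Eq.trans (congrArg η (Subtype.ext ?_)) η.source
          exact hz0
        rw [e1]
        refine Eq.trans (congrArg γ (Subtype.ext ?_)) γ.target
        show 2 * ((z + 1) / 2) = 1
        rw [hz0]; norm_num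
      · congr 1
        ext
        show 2 * ((z + 1) / 2) - 1 = z
        ring
    · rw [Real.dist_eq, ← sub_div, abs_div, abs_two]
      rw [Real.dist_eq] at hst
      have : s + 1 - (t + 1) = s - t := by ring
      rw [this]
      linarith [abs_nonneg (s - t)]
  rw [val_eq hu, val_eq h1, val_eq h2]
  norm_num

theorem Coc.val_local (h : Coc U V φ) {a b : X} (γ : Path a b)
    (hγ : (∀ t, γ t ∈ U) ∨ (∀ t, γ t ∈ V)) : val φ γ = φ γ.toContinuousMap := by
  have hc : ∀ r s t : ℝ, φ (seg1 (ext1 γ) r s) * φ (seg1 (ext1 γ) s t) = φ (seg1 (ext1 γ) r t) := by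
    intro r s t
    have := h.coc ((ext1 γ).comp ⟨Prod.fst, continuous_fst⟩) (r, 0) (s, 0) (t, 0)
      (by
        rcases hγ with hγ | hγ
        · left; intro z _; exact hγ _
        · right; intro z _; exact hγ _)
    have e : ∀ r s : ℝ, seg2 ((ext1 γ).comp ⟨Prod.fst, continuous_fst⟩) (r, 0) (s, 0)
        = seg1 (ext1 γ) r s := by
      intro r s
      ext τ
      simp [seg1, seg2, AffineMap.lineMap_apply]
    simpa only [e] using this
  have hp : Prim φ (ext1 γ) (fun t => φ (seg1 (ext1 γ) 0 t)) :=
    ⟨1, one_pos, fun s t _ _ _ => (hc 0 s t).symm⟩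
  have h0 : φ (seg1 (ext1 γ) 0 0) = 1 := by simpa using hc 0 0 0
  rw [val_eq hp, h0, inv_one, one_mul]
  congr 1
  ext τ
  simp [seg1, ext1, AffineMap.lineMap_apply]

theorem Coc.val_refl (h : Coc U V φ) (a : X) : val φ (Path.refl a) = 1 := by
  have hp : ∀ u, Prim φ (ext1 (Path.refl a)) u → (u 0)⁻¹ * u 1 = 1 := by
    intro u hu
    have h2 : Prim φ (ext1 (Path.refl a)) (fun s => (1 : G)) := by
      have hl : φ (Path.refl a).toContinuousMap = 1 := by
        have := h.coc (ContinuousMap.const _ a) 0 0 0 (by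
          rcases h.cov a with ha | ha
          · left; intro z _; exact ha
          · right; intro z _; exact ha)
        have e : seg2 (ContinuousMap.const (ℝ × ℝ) a) 0 0 = (Path.refl a).toContinuousMap := by
          ext; rfl
        rw [e] at this
        simpa using this
      refine ⟨1, one_pos, fun s t _ _ _ => ?_⟩
      have e : seg1 (ext1 (Path.refl a)) s t = (Path.refl a).toContinuousMap := by
        ext; rfl
      rw [e, hl, one_mul]
    have := Prim.unique hu h2
    simpa using this
  obtain ⟨u, hu⟩ := h.prim1 (ext1 (Path.refl a))
  rw [val_eq hu, hp u hu]

theorem Coc.val_homotopic (h : Coc U V φ) {a b : X} {γ η : Path a b} (H : γ.Homotopic η) :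
    val φ γ = val φ η := by
  obtain ⟨H⟩ := H
  let F : C(ℝ × ℝ, X) := ⟨fun z => H (Set.projIcc 0 1 zero_le_one z.2, Set.projIcc 0 1 zero_le_one z.1),
    by
      have : Continuous (Set.projIcc (0 : ℝ) 1 zero_le_one) := continuous_projIcc
      fun_prop⟩
  obtain ⟨u, ε, hε, hu⟩ := h.prim2 F
  have nb : ∀ s t : ℝ, s ∈ Set.Icc (0 : ℝ) 1 → t ∈ Set.Icc (0 : ℝ) 1 → ‖(s, t)‖ ≤ 1 := by
    intro s t hs ht
    simp only [Prod.norm_def, Real.norm_eq_abs, sup_le_iff, abs_le]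
    exact ⟨⟨by linarith [hs.1], hs.2⟩, ⟨by linarith [ht.1], ht.2⟩⟩
  have hz : (0 : ℝ) ∈ Set.Icc (0 : ℝ) 1 := by simp
  have ho : (1 : ℝ) ∈ Set.Icc (0 : ℝ) 1 := by simp
  have p0 : Prim φ (ext1 γ) (fun s => u (s, 0)) := by
    refine ⟨ε, hε, fun s t hs ht hst => ?_⟩
    beta_reduce
    rw [hu (s, 0) (t, 0) (nb _ _ hs hz) (nb _ _ ht hz) (by simpa [Prod.dist_eq, hε] using hst)]
    congr 2
    ext τ
    simp [seg1, seg2, AffineMap.lineMap_apply, F, ext1, Path.extend, Set.IccExtend]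
  have p1 : Prim φ (ext1 η) (fun s => u (s, 1)) := by
    refine ⟨ε, hε, fun s t hs ht hst => ?_⟩
    beta_reduce
    rw [hu (s, 1) (t, 1) (nb _ _ hs ho) (nb _ _ ht ho) (by simpa [Prod.dist_eq, hε] using hst)]
    congr 2
    ext τ
    simp [seg1, seg2, AffineMap.lineMap_apply, F, ext1, Path.extend, Set.IccExtend]
  have q0 : Prim φ (ext1 (Path.refl a)) (fun s => u (0, s)) := by
    refine ⟨ε, hε, fun s t hs ht hst => ?_⟩
    beta_reduce
    rw [hu (0, s) (0, t) (nb _ _ hz hs) (nb _ _ hz ht) (by simpa [Prod.dist_eq, hε] using hst)]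
    congr 2
    ext τ
    simp [seg1, seg2, AffineMap.lineMap_apply, F, ext1, Path.extend, Set.IccExtend]
  have q1 : Prim φ (ext1 (Path.refl b)) (fun s => u (1, s)) := by
    refine ⟨ε, hε, fun s t hs ht hst => ?_⟩
    beta_reduce
    rw [hu (1, s) (1, t) (nb _ _ ho hs) (nb _ _ ho ht) (by simpa [Prod.dist_eq, hε] using hst)]
    congr 2
    ext τ
    simp [seg1, seg2, AffineMap.lineMap_apply, F, ext1, Path.extend, Set.IccExtend]
  have e0 := val_eq q0
  have e1 := val_eq q1
  rw [h.val_refl] at e0 e1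
  have e0' : u (0, 0) = u (0, 1) := inv_mul_eq_one.1 e0.symm
  have e1' : u (1, 0) = u (1, 1) := inv_mul_eq_one.1 e1.symm
  rw [val_eq p0, val_eq p1, e0', e1']

theorem Coc.val_symm (h : Coc U V φ) {a b : X} (γ : Path a b) :
    val φ γ.symm = (val φ γ)⁻¹ := by
  have := h.val_homotopic (Path.Homotopic.trans_symm γ)
  rw [h.val_trans, h.val_refl] at this
  exact (inv_eq_of_mul_eq_one_right this).symm

/-- The homomorphism (up to order) on the fundamental group. -/
noncomputable def Coc.hom (h : Coc U V φ) (x : X) : FundamentalGroup X x →* G where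
  toFun g := Quotient.lift (fun γ : Path x x => (val φ γ)⁻¹)
    (fun _ _ H => by rw [h.val_homotopic H]) (FundamentalGroup.toPath g)
  map_one' := by
    show (val φ (Path.refl x))⁻¹ = 1
    rw [h.val_refl, inv_one]
  map_mul' := by
    intro a b
    induction a using Path.Homotopic.Quotient.ind with | mk a =>
    induction b using Path.Homotopic.Quotient.ind with | mk b =>
    show (val φ (b.trans a))⁻¹ = (val φ a)⁻¹ * (val φ b)⁻¹
    rw [h.val_trans, mul_inv_rev]

theorem Coc.hom_loopClass (h : Coc U V φ) {x p : X} (α : Path x p) (β : Path p p) :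
    h.hom x (loopClass α β) = 1 ↔ val φ β = 1 := by
  show (val φ ((α.trans β).trans α.symm))⁻¹ = 1 ↔ _
  rw [h.val_trans, h.val_trans, h.val_symm, inv_eq_one, conj_eq_one_iff]

end VK

section Phi
variable {X : Type*} [TopologicalSpace X]

/-- Class of `α f β⁻¹`. -/
noncomputable def cls {b p q : X} (α : Path b p) (f : Path p q) (β : Path b q) :
    FundamentalGroup X b :=
  FundamentalGroup.fromPath (Path.Homotopic.Quotient.mk ((α.trans f).trans β.symm))

theorem loopClass_eq_cls {b p : X} (α : Path b p) (f : Path p p) :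
    loopClass α f = cls α f α := rfl

theorem cls_mul {b p q s : X} (α : Path b p) (f : Path p q) (β : Path b q) (g : Path q s)
    (γ : Path b s) : cls β g γ * cls α f β = cls α (f.trans g) γ := by
  show Path.Homotopic.Quotient.trans (Path.Homotopic.Quotient.mk ((α.trans f).trans β.symm))
    (Path.Homotopic.Quotient.mk ((β.trans g).trans γ.symm)) =
    Path.Homotopic.Quotient.mk ((α.trans (f.trans g)).trans γ.symm)
  simp only [Path.Homotopic.Quotient.mk_trans, Path.Homotopic.Quotient.mk_symm]
  grind

theorem cls_congr {b p q : X} (α : Path b p) {f g : Path p q} (β : Path b q)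
    (h : f.Homotopic g) : cls α f β = cls α g β := by
  have h' : Path.Homotopic.Quotient.mk f = Path.Homotopic.Quotient.mk g :=
    Path.Homotopic.Quotient.eq.2 h
  show Path.Homotopic.Quotient.mk _ = Path.Homotopic.Quotient.mk _
  simp only [Path.Homotopic.Quotient.mk_trans, h']

theorem cls_shift {b a p q : X} (τ : Path b a) (α : Path a p) (f : Path p q) (β : Path a q) :
    cls (τ.trans α) f (τ.trans β) = cls τ ((α.trans f).trans β.symm) τ := by
  show Path.Homotopic.Quotient.mk _ = Path.Homotopic.Quotient.mk _
  simp only [Path.trans_symm, Path.Homotopic.Quotient.mk_trans]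
  grind

theorem cls_conj {b p : X} (α β : Path b p) (f : Path p p) :
    ∃ g : FundamentalGroup X b, cls α f α = g * cls β f β * g⁻¹ := by
  refine ⟨cls β (Path.refl p) α, ?_⟩
  have h1 : (cls β (Path.refl p) α) * cls α (Path.refl p) β = 1 := by
    rw [cls_mul]
    show Path.Homotopic.Quotient.mk _ = Path.Homotopic.Quotient.refl _
    simp
  have h2 : (cls β (Path.refl p) α)⁻¹ = cls α (Path.refl p) β := inv_eq_of_mul_eq_one_right h1
  rw [h2, mul_assoc, cls_mul, cls_mul]
  apply cls_congr
  rw [← Path.Homotopic.Quotient.eq]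
  simp

open Classical in
theorem exists_tau (A : Set X) (b : X) :
    ∃ τ : ∀ p, Joined b p → Path b p, ∀ p q (f : Path p q) (hp : Joined b p) (hq : Joined b q),
      (∀ t, f t ∈ A) → ∃ (a : X) (α : Path b a) (β : Path a a), (∀ t, β t ∈ A) ∧
        cls (τ p hp) f (τ q hq) = loopClass α β := by
  let repS : Set X → X := fun S => if h : S.Nonempty then h.some else b
  let rep : X → X := fun p => repS {q | JoinedIn A p q}
  have hrep : ∀ p, p ∈ A → JoinedIn A p (rep p) := by
    intro p hp
    have hne : ({q | JoinedIn A p q} : Set X).Nonempty := ⟨p, JoinedIn.refl hp⟩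
    have : rep p = hne.some := dif_pos hne
    rw [this]
    exact hne.some_mem
  have ex : ∀ p, Joined b p → ∃ α : Path b p, p ∈ A →
      ∃ (hj : Joined b (rep p)) (ρ : Path (rep p) p), (∀ t, ρ t ∈ A) ∧
        α = hj.somePath.trans ρ := by
    intro p hp
    by_cases hA : p ∈ A
    · have hj : Joined b (rep p) := hp.trans (hrep p hA).joined
      exact ⟨hj.somePath.trans (hrep p hA).symm.somePath, fun _ => ⟨hj, _,
        (hrep p hA).symm.somePath_mem, rfl⟩⟩
    · exact ⟨hp.somePath, fun h => absurd h hA⟩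
  choose τ hτ using ex
  refine ⟨τ, fun p q f hp hq hf => ?_⟩
  have hpA : p ∈ A := by simpa using hf 0
  have hqA : q ∈ A := by simpa using hf 1
  have hpq : JoinedIn A p q := ⟨f, hf⟩
  have e : rep q = rep p := by
    show repS _ = repS _
    congr 1
    ext z
    exact ⟨fun h => hpq.trans h, fun h => hpq.symm.trans h⟩
  have Hq := hτ q hq hqA
  rw [e] at Hq
  obtain ⟨hj, ρ, hρ, h1⟩ := hτ p hp hpA
  obtain ⟨hj', ρ', hρ', h2⟩ := Hq
  refine ⟨rep p, hj.somePath, (ρ.trans f).trans ρ'.symm, ?_, ?_⟩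
  · intro t
    have : Set.range ((ρ.trans f).trans ρ'.symm) ⊆ A := by
      rw [Path.trans_range, Path.trans_range, Path.symm_range]
      rintro z ((⟨t, rfl⟩ | ⟨t, rfl⟩) | ⟨t, rfl⟩)
      exacts [hρ t, hf t, hρ' t]
    exact this ⟨t, rfl⟩
  · rw [h1, h2, cls_shift]
    rfl

open Classical in
theorem exists_phi {U V : Set X} (oU : IsOpen U) (oV : IsOpen V) (cov : ∀ x, x ∈ U ∨ x ∈ V)
    (b : U) (N : Subgroup (FundamentalGroup U b)) [N.Normal]
    (hN : ∀ (p : U) (α : Path b p) (β : Path p p), (∀ t, (β t : X) ∈ V) → loopClass α β ∈ N) :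
    ∃ φ : C(I, X) → (FundamentalGroup U b ⧸ N), Coc U V φ ∧
      (∀ f, (∀ t, f t ∈ V) → φ f = 1) ∧
      (∀ (p : U) (β : Path p p), (∀ α : Path b p, loopClass α β ∈ N) →
        φ (β.map continuous_subtype_val).toContinuousMap = 1) ∧
      (∀ β : Path b b, φ (β.map continuous_subtype_val).toContinuousMap = 1 →
        loopClass (Path.refl b) β ∈ N) := by
  obtain ⟨τ, hτ⟩ := exists_tau ((↑) ⁻¹' V : Set U) b
  let P : C(I, X) → (Σ p q : U, Path p q) → Prop := fun f s =>
    Joined b s.1 ∧ ∀ t, (s.2.2 t : X) = f t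
  let φ : C(I, X) → (FundamentalGroup U b ⧸ N) := fun f =>
    if h : ∃ s, P f s then
      ((cls (τ _ h.choose_spec.1) h.choose.2.2 (τ _ (h.choose_spec.1.trans ⟨h.choose.2.2⟩)) :
        FundamentalGroup U b) : FundamentalGroup U b ⧸ N)⁻¹
    else 1
  have phi_eq : ∀ (f : C(I, X)) (p q : U) (γ : Path p q) (hp : Joined b p) (hq : Joined b q),
      (∀ t, (γ t : X) = f t) →
      φ f = ((cls (τ p hp) γ (τ q hq) : FundamentalGroup U b) : FundamentalGroup U b ⧸ N)⁻¹ := by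
    intro f p q γ hp hq hγ
    have h : ∃ s, P f s := ⟨⟨p, q, γ⟩, hp, hγ⟩
    have key : ∀ (s : Σ p q : U, Path p q) (hs : P f s),
        cls (τ _ hs.1) s.2.2 (τ _ (hs.1.trans ⟨s.2.2⟩)) = cls (τ p hp) γ (τ q hq) := by
      rintro ⟨p', q', γ'⟩ ⟨h1, h2⟩
      dsimp only at h1 h2 ⊢
      have e1 : p' = p := by
        have := (h2 0).trans (hγ 0).symm
        simpa using Subtype.ext this
      have e2 : q' = q := by
        have := (h2 1).trans (hγ 1).symm
        simpa using Subtype.ext this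
      subst e1 e2
      have e3 : γ' = γ := by
        ext t
        exact (h2 t).trans (hγ t).symm
      subst e3
      rfl
    have := key _ h.choose_spec
    show dite _ _ _ = _
    rw [dif_pos h, this]
  have phi_one : ∀ f, (∀ s, ¬ P f s) → φ f = 1 := by
    intro f hf
    exact dif_neg (by rintro ⟨s, hs⟩; exact hf s hs)
  have phiV : ∀ f, (∀ t, f t ∈ V) → φ f = 1 := by
    intro f hf
    by_cases h : ∃ s, P f s
    · obtain ⟨⟨p, q, γ⟩, h1, h2⟩ := h
      dsimp only at h1 h2
      rw [phi_eq f p q γ h1 (h1.trans ⟨γ⟩) h2]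
      obtain ⟨a, α, β, hβ, e⟩ := hτ p q γ h1 (h1.trans ⟨γ⟩) (fun t => by
        show (γ t : X) ∈ V
        rw [h2]; exact hf t)
      rw [e, inv_eq_one, QuotientGroup.eq_one_iff]
      exact hN a α β hβ
    · exact phi_one f (fun s hs => h ⟨s, hs⟩)
  refine ⟨φ, ⟨oU, oV, cov, ?_⟩, phiV, ?_, ?_⟩
  · intro F p q s hF
    have hp : p ∈ convexHull ℝ {p, q, s} := subset_convexHull ℝ _ (by simp)
    have hq : q ∈ convexHull ℝ {p, q, s} := subset_convexHull ℝ _ (by simp)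
    have hs : s ∈ convexHull ℝ {p, q, s} := subset_convexHull ℝ _ (by simp)
    have hC : Convex ℝ (convexHull ℝ {p, q, s}) := convex_convexHull ℝ _
    generalize convexHull ℝ {p, q, s} = C at *
    rcases hF with hF | hF
    · let Fr : C(C, U) := ⟨fun z => ⟨F z, hF z z.2⟩, by fun_prop⟩
      let L : ∀ v w : C, Path v w := fun v w =>
        { toFun := fun t => ⟨AffineMap.lineMap (v : ℝ × ℝ) w (t : ℝ), hC.lineMap_mem v.2 w.2 t.2⟩
          continuous_toFun := by fun_prop
          source' := by ext <;> simp
          target' := by ext <;> simp }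
      have hL : ∀ v w : C, ∀ t, (((L v w).map Fr.continuous) t : X) = seg2 F v w t := by
        intro v w t
        rfl
      let p' : C := ⟨p, hp⟩
      let q' : C := ⟨q, hq⟩
      let s' : C := ⟨s, hs⟩
      by_cases hj : Joined b (Fr p')
      · have hjq : Joined b (Fr q') := hj.trans ⟨(L p' q').map Fr.continuous⟩
        have hjs : Joined b (Fr s') := hj.trans ⟨(L p' s').map Fr.continuous⟩
        rw [phi_eq _ _ _ _ hj hjq (hL p' q'), phi_eq _ _ _ _ hjq hjs (hL q' s'),
          phi_eq _ _ _ _ hj hjs (hL p' s'), ← mul_inv_rev, ← QuotientGroup.mk_mul, cls_mul]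
        congr 2
        apply cls_congr
        have : ContractibleSpace C := hC.contractibleSpace ⟨p, hp⟩
        have hh : ((L p' q').trans (L q' s')).Homotopic (L p' s') :=
          SimplyConnectedSpace.paths_homotopic _ _
        have := hh.map Fr
        rwa [Path.map_trans] at this
      · have none : ∀ v w : C, φ (seg2 F v w) = 1 := by
          intro v w
          apply phi_one
          rintro ⟨a, c, γ⟩ ⟨h1, h2⟩
          dsimp only at h1 h2
          have e : a = Fr v := by
            have := h2 0
            rw [γ.source] at this
            apply Subtype.ext
            rw [this]
            simp [seg2, Fr]
          subst e
          exact hj (h1.trans ⟨(L v p').map Fr.continuous⟩)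
        have n1 := none p' q'
        have n2 := none q' s'
        have n3 := none p' s'
        rw [n1, n2, n3, one_mul]
    · have one : ∀ v w, v ∈ C → w ∈ C → φ (seg2 F v w) = 1 := by
        intro v w hv hw
        exact phiV _ (fun t => hF _ (hC.lineMap_mem hv hw t.2))
      rw [one p q hp hq, one q s hq hs, one p s hp hs, one_mul]
  · intro p β hβ
    by_cases hj : Joined b p
    · rw [phi_eq _ p p β hj hj (fun t => rfl), inv_eq_one, QuotientGroup.eq_one_iff]
      exact hβ _
    · apply phi_one
      rintro ⟨a, c, γ⟩ ⟨h1, h2⟩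
      dsimp only at h1 h2
      have e : a = p := by
        have := h2 0
        rw [γ.source] at this
        apply Subtype.ext
        rw [this]
        simp
      subst e
      exact hj h1
  · intro β hβ
    have hj : Joined b b := Joined.refl b
    rw [phi_eq _ b b β hj hj (fun t => rfl), inv_eq_one, QuotientGroup.eq_one_iff] at hβ
    obtain ⟨g, hg⟩ := cls_conj (Path.refl b) (τ b hj) β
    rw [loopClass_eq_cls, hg]
    exact Subgroup.Normal.conj_mem inferInstance _ hβ g

end Phi

section Main

/-- The cut-off group with arbitrary basepoint `b` and center `z`. -/
noncomputable def zGroup (Z : Type*) [MetricSpace Z] (z b : Z) (δ R : ℝ) :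
    Subgroup (FundamentalGroup Z b) :=
  Subgroup.normalClosure
    {g | ∃ (y : Z) (β : Path y y) (α : Path b y),
      ((∃ c : Z, ∀ t, β t ∈ Metric.ball c δ) ∨ (∀ t, β t ∉ Metric.closedBall z R)) ∧
      g = loopClass α β}

instance zGroup_normal (Z : Type*) [MetricSpace Z] (z b : Z) (δ R : ℝ) :
    (zGroup Z z b δ R).Normal :=
  Subgroup.normalClosure_normal

/-- All small loops are killed at the smaller scale. -/
def SmallKilled (Z : Type*) [MetricSpace Z] (z : Z) (δ δ' R : ℝ) : Prop :=
  ∀ (b : Z) (β : Path b b), (∃ c : Z, ∀ t, β t ∈ Metric.ball c δ') →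
    loopClass (Path.refl b) β ∈ zGroup Z z b δ R

/-- Push-forward of loops followed by change of basepoint. -/
noncomputable def pushHom {Z W : Type*} [TopologicalSpace Z] [TopologicalSpace W] (g : C(Z, W))
    {b : Z} {w : W} (η : Path w (g b)) : FundamentalGroup Z b →* FundamentalGroup W w where
  toFun q := Quotient.lift (fun γ : Path b b => cls η (γ.map g.continuous) η)
    (fun _ _ H => cls_congr _ _ (Path.Homotopic.map H g)) (FundamentalGroup.toPath q)
  map_one' := by
    show cls η ((Path.refl b).map g.continuous) η = 1
    show Path.Homotopic.Quotient.mk _ = Path.Homotopic.Quotient.refl _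
    have : (Path.refl b).map g.continuous = Path.refl (g b) := rfl
    rw [this]
    simp
  map_mul' := by
    intro a b
    induction a using Path.Homotopic.Quotient.ind with | mk a =>
    induction b using Path.Homotopic.Quotient.ind with | mk b =>
    show cls η ((b.trans a).map g.continuous) η = cls η _ η * cls η _ η
    rw [cls_mul, Path.map_trans]

theorem push_mem {Z W : Type*} [MetricSpace Z] [TopologicalSpace W] (g : C(Z, W))
    {z b : Z} {w : W} (η : Path w (g b)) {δ R : ℝ} (N : Subgroup (FundamentalGroup W w)) [N.Normal]
    (h : ∀ (y : Z) (β : Path y y) (α : Path w (g y)),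
      ((∃ c : Z, ∀ t, β t ∈ Metric.ball c δ) ∨ (∀ t, β t ∉ Metric.closedBall z R)) →
      loopClass α (β.map g.continuous) ∈ N) (β : Path b b)
    (hβ : loopClass (Path.refl b) β ∈ zGroup Z z b δ R) :
    loopClass η (β.map g.continuous) ∈ N := by
  have hle : zGroup Z z b δ R ≤ N.comap (pushHom g η) := by
    apply Subgroup.normalClosure_le_normal
    rintro _ ⟨y, β, α, hb, rfl⟩
    show cls η (((α.trans β).trans α.symm).map g.continuous) η ∈ N
    have := h y β (η.trans (α.map g.continuous)) hb
    rw [loopClass_eq_cls, cls_shift] at this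
    rwa [Path.map_trans, Path.map_trans]
  have h1 := hle hβ
  have h2 : pushHom g η (loopClass (Path.refl b) β) = loopClass η (β.map g.continuous) := by
    show cls η ((((Path.refl b).trans β).trans (Path.refl b).symm).map g.continuous) η = cls η _ η
    apply cls_congr
    apply Path.Homotopic.map (p := ((Path.refl b).trans β).trans (Path.refl b).symm) (q := β) _ g
    rw [← Path.Homotopic.Quotient.eq]
    simp
  rw [← h2]
  exact h1

theorem SmallKilled.transport {Z W : Type*} [MetricSpace Z] [MetricSpace W] (e : Z ≃ᵢ W)
    {z : Z} {w : W} (hz : e z = w) {δ δ' R : ℝ} (h : SmallKilled Z z δ δ' R) :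
    SmallKilled W w δ δ' R := by
  intro b' β' hβ'
  obtain ⟨b, rfl⟩ := e.surjective b'
  let β : Path b b := (β'.map e.symm.continuous).cast (by simp) (by simp)
  have hβ : ∀ t, β t = e.symm (β' t) := fun t => rfl
  obtain ⟨c, hc⟩ := hβ'
  have h1 := h b β ⟨e.symm c, fun t => by
    rw [hβ, Metric.mem_ball, e.symm.dist_eq]; exact hc t⟩
  have h2 := push_mem (⟨e, e.continuous⟩ : C(Z, W)) (Path.refl (e b)) (zGroup W w (e b) δ R)
    (by
      intro y β α hb
      apply Subgroup.subset_normalClosure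
      refine ⟨_, _, α, ?_, rfl⟩
      rcases hb with ⟨c, hc⟩ | hb
      · left
        refine ⟨e c, fun t => ?_⟩
        show dist (e (β t)) (e c) < δ
        rw [e.dist_eq]; exact hc t
      · right
        intro t ht
        apply hb t
        have : dist (e (β t)) w ≤ R := ht
        rw [← hz, e.dist_eq] at this
        exact this) β h1
  have e2 : β.map (⟨e, e.continuous⟩ : C(Z, W)).continuous = β' := by
    ext t
    show e (β t) = β' t
    rw [hβ]; simp
  rwa [e2] at h2

theorem cut_mono (X : Type*) [MetricSpace X] (x : X) {δ δ' : ℝ} (R : ℝ) (h : δ ≤ δ') :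
    cutCoveringGroup X x δ R ≤ cutCoveringGroup X x δ' R := by
  apply Subgroup.normalClosure_mono
  rintro _ ⟨y, β, α, hb, rfl⟩
  refine ⟨y, β, α, ?_, rfl⟩
  rcases hb with ⟨c, hc⟩ | hb
  · exact Or.inl ⟨c, fun t => Metric.ball_subset_ball h (hc t)⟩
  · exact Or.inr hb

theorem small_bounds {X : Type*} [MetricSpace X] {x c y : X} {δ R r : ℝ} (hr : R + 2 * δ < r)
    {β : Path y y} (hc : ∀ t, β t ∈ Metric.ball c δ) {t : I} (ht : β t ∈ Metric.closedBall x R) :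
    c ∈ Metric.ball x r ∧ ∀ s, β s ∈ Metric.ball x r := by
  have h1 : dist (β t) c < δ := hc t
  have h2 : dist (β t) x ≤ R := ht
  have h0 : 0 ≤ dist (β t) c := dist_nonneg
  constructor
  · have := dist_triangle_left c x (β t)
    rw [Metric.mem_ball]; linarith
  · intro s
    have h3 : dist (β s) c < δ := hc s
    have h4 := dist_triangle (β s) c x
    have h5 := dist_triangle_left c x (β t)
    rw [Metric.mem_ball]; linarith

/-- Corestriction of a loop. -/
def restr {X : Type*} [TopologicalSpace X] {U : Set X} {y : X} (β : Path y y) (h : ∀ t, β t ∈ U)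
    (hy : y ∈ U) : Path (⟨y, hy⟩ : U) ⟨y, hy⟩ where
  toFun t := ⟨β t, h t⟩
  continuous_toFun := by fun_prop
  source' := by simp
  target' := by simp

theorem cut_le_of_small {X : Type*} [MetricSpace X] (x : X) {δ δ' R r : ℝ}
    (hr : R + 2 * δ' < r) (h0 : x ∈ Metric.ball x r)
    (h : SmallKilled (Metric.ball x r) ⟨x, h0⟩ δ δ' R) :
    cutCoveringGroup X x δ' R ≤ cutCoveringGroup X x δ R := by
  apply Subgroup.normalClosure_le_normal
  rintro _ ⟨y, β, α, hb, rfl⟩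
  by_cases hout : ∀ t, β t ∉ Metric.closedBall x R
  · exact Subgroup.subset_normalClosure ⟨y, β, α, Or.inr hout, rfl⟩
  · rcases hb with ⟨c, hc⟩ | hb
    · push Not at hout
      obtain ⟨t, ht⟩ := hout
      obtain ⟨hcU, hβU⟩ := small_bounds hr hc ht
      have hy : y ∈ Metric.ball x r := by simpa using hβU 0
      have h1 := h ⟨y, hy⟩ (restr β hβU hy) ⟨⟨c, hcU⟩, fun t => hc t⟩
      have h2 := push_mem (⟨Subtype.val, continuous_subtype_val⟩ : C(Metric.ball x r, X))
        (b := ⟨y, hy⟩) (w := x) α (cutCoveringGroup X x δ R)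
        (by
          intro y β α hb
          apply Subgroup.subset_normalClosure
          refine ⟨_, _, α, ?_, rfl⟩
          rcases hb with ⟨c, hc⟩ | hb
          · exact Or.inl ⟨c, fun t => hc t⟩
          · exact Or.inr fun t ht => hb t ht) _ h1
      exact h2
    · exact absurd hb hout

theorem small_of_cut_le {X : Type*} [MetricSpace X] [PathConnectedSpace X] (x : X)
    {δ δ' R r : ℝ} (hRr : R < r)
    (hr : R + 2 * δ < r) (h0 : x ∈ Metric.ball x r)
    (h : cutCoveringGroup X x δ' R ≤ cutCoveringGroup X x δ R) :
    SmallKilled (Metric.ball x r) ⟨x, h0⟩ δ δ' R := by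
  intro b β hβ
  obtain ⟨φ, hφ, hV, h1, h2⟩ := exists_phi (U := Metric.ball x r) (V := (Metric.closedBall x R)ᶜ)
    Metric.isOpen_ball Metric.isClosed_closedBall.isOpen_compl
    (by
      intro z
      rcases lt_or_ge (dist z x) r with hz | hz
      · exact Or.inl hz
      · refine Or.inr fun hz' => ?_
        have : dist z x ≤ R := hz'
        linarith) b (zGroup (Metric.ball x r) ⟨x, h0⟩ b δ R)
    (by
      intro p α β hβ
      exact Subgroup.subset_normalClosure ⟨p, β, α, Or.inr fun t ht => hβ t ht, rfl⟩)
  have hker : cutCoveringGroup X x δ R ≤ (hφ.hom x).ker := by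
    apply Subgroup.normalClosure_le_normal
    rintro _ ⟨y, β, α, hb, rfl⟩
    show hφ.hom x (loopClass α β) = 1
    rw [hφ.hom_loopClass]
    by_cases hout : ∀ t, β t ∉ Metric.closedBall x R
    · rw [hφ.val_local β (Or.inr hout)]
      exact hV _ hout
    · rcases hb with ⟨c, hc⟩ | hb
      · push Not at hout
        obtain ⟨t, ht⟩ := hout
        obtain ⟨hcU, hβU⟩ := small_bounds hr hc ht
        have hy : y ∈ Metric.ball x r := by simpa using hβU 0
        rw [hφ.val_local β (Or.inl hβU)]
        exact h1 ⟨y, hy⟩ (restr β hβU hy) (fun α => Subgroup.subset_normalClosure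
          ⟨_, _, α, Or.inl ⟨⟨c, hcU⟩, fun t => hc t⟩, rfl⟩)
      · exact absurd hb hout
  apply h2
  obtain ⟨c, hc⟩ := hβ
  let α : Path x (b : X) := PathConnectedSpace.somePath x b
  let βX : Path (b : X) b := β.map continuous_subtype_val
  have hm : loopClass α βX ∈ cutCoveringGroup X x δ' R :=
    Subgroup.subset_normalClosure ⟨_, _, _, Or.inl ⟨c, fun t => hc t⟩, rfl⟩
  have hk : hφ.hom x (loopClass α βX) = 1 := hker (h hm)
  rw [hφ.hom_loopClass, hφ.val_local βX (Or.inl fun t => (β t).2)] at hk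
  exact hk

theorem cutCovSpec_sub
    {X Y : Type*} [MetricSpace X]
    [MetricSpace Y] [PathConnectedSpace Y] (x : X) (y : Y)
    (D R r : ℝ) (hD : 0 < D) (hR : 0 < R) (hr : 3 * (R + 2 * D) < r)
    (hx : x ∈ Metric.ball x r) (hy : y ∈ Metric.ball y r)
    (f : (Metric.ball x r) ≃ᵢ (Metric.ball y r)) (hf : f ⟨x, hx⟩ = ⟨y, hy⟩) :
    cutCovSpec X x R ∩ Set.Ioc 0 D ⊆ cutCovSpec Y y R ∩ Set.Ioc 0 D := by
  rintro δ ⟨⟨h0, h⟩, hδ⟩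
  refine ⟨⟨h0, fun δ' hδ' heq => ?_⟩, hδ⟩
  have hδD : δ ≤ D := hδ.2
  have hlt : δ < min δ' (2 * D) := lt_min hδ' (by linarith)
  have h2D : min δ' (2 * D) ≤ 2 * D := min_le_right _ _
  have hle : cutCoveringGroup Y y (min δ' (2 * D)) R ≤ cutCoveringGroup Y y δ R :=
    (cut_mono Y y R (min_le_left _ _)).trans heq.le
  have hS := small_of_cut_le y (by linarith) (by linarith) hy hle
  have hS' := hS.transport f.symm (z := ⟨y, hy⟩) (w := ⟨x, hx⟩) (by rw [← hf]; simp)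
  have hle' := cut_le_of_small x (by linarith) hx hS'
  exact h _ hlt (le_antisymm hle' (cut_mono X x R hlt.le))

end Main


/-- If balls `B(x,r) ⊆ X` and `B(y,r) ⊆ Y` (restricted metrics) are
isometric via an isometry carrying `x` to `y`, and `r > 3(R + 2D)`, then the `R`
cut-off covering spectra of `(X,x)` and `(Y,y)` agree within `(0, D]`. -/
theorem cutCovSpec_eq_of_isometric_balls
    {X Y : Type*} [MetricSpace X] [PathConnectedSpace X]
    [MetricSpace Y] [PathConnectedSpace Y] (x : X) (y : Y)
    (D R r : ℝ) (hD : 0 < D) (hR : 0 < R) (hr : 3 * (R + 2 * D) < r)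
    (f : (Metric.ball x r) ≃ᵢ (Metric.ball y r))
    (hf : f ⟨x, Metric.mem_ball_self (by linarith)⟩
        = ⟨y, Metric.mem_ball_self (by linarith)⟩) :
    cutCovSpec X x R ∩ Set.Ioc 0 D = cutCovSpec Y y R ∩ Set.Ioc 0 D := by
  have hx : x ∈ Metric.ball x r := Metric.mem_ball_self (by linarith)
  have hy : y ∈ Metric.ball y r := Metric.mem_ball_self (by linarith)
  apply Set.Subset.antisymm
  · exact cutCovSpec_sub x y D R r hD hR hr hx hy f hf
  · exact cutCovSpec_sub y x D R r hD hR hr hy hx f.symm (by rw [← hf]; simp)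
end

section
/- Let Z₁ and Z₂ be compact geodesic metric spaces with basepoints p₁ and p₂, let ε > 0, and let f : Z₁ → Z₂ be a pointed ε-Hausdorff approximation. Let δ₁ > 10ε, δ₂ > δ₁ + 10ε, and let s₁ > 0 and 0 < s₂ < s₁ − 5ε. Then there exists a surjective group homomorphism Φ from the quotient group π₁(Z₁,p₁)/π₁^{cut}(Z₁,δ₁,s₁,p₁) onto the quotient group π₁(Z₂,p₂)/π₁^{cut}(Z₂,δ₂,s₂,p₂). -/
/- Common definitions: path length, length/geodesic spaces, δ-covering groups,
   covering spectra, cut-off covering groups and spectra, free homotopy,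
   loops-to-infinity. -/

open Metric Filter
open scoped NNReal ENNReal unitInterval

attribute [local instance] Path.Homotopic.setoid

/-- Step-by-step induction along the unit interval. -/
theorem interval_ind (P : I → Prop) (h0 : P 0) (η : ℝ) (hη : 0 < η)
    (hs : ∀ s t : I, dist s t < η → P s → P t) : ∀ t, P t := by
  have hop : IsOpen {t | P t} := by
    rw [Metric.isOpen_iff]
    intro s hps
    refine ⟨η, hη, fun t ht => hs s t ?_ hps⟩
    rw [dist_comm]; exact ht
  have hcl : IsClosed {t | P t} := by
    rw [← isOpen_compl_iff, Metric.isOpen_iff]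
    intro s hps
    refine ⟨η, hη, fun t ht hpt => hps (hs t s ht hpt)⟩
  have := IsClopen.eq_univ (s := {t | P t}) ⟨hcl, hop⟩ ⟨0, h0⟩
  intro t
  have ht : t ∈ {t | P t} := by rw [this]; trivial
  exact ht

/-- A group-valued functor on paths. -/
structure PRep (X : Type*) [TopologicalSpace X] (G : Type*) [Group G] where
  F : ∀ {x y : X}, Path x y → G
  trans : ∀ {x y z : X} (p : Path x y) (q : Path y z), F (p.trans q) = F q * F p
  homot : ∀ {x y : X} (p q : Path x y), p.Homotopic q → F p = F q

namespace PRep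
variable {X : Type*} [TopologicalSpace X] {G : Type*} [Group G] (R : PRep X G)

theorem F_refl (x : X) : R.F (Path.refl x) = 1 := by
  have := R.trans (Path.refl x) (Path.refl x)
  rw [Path.refl_trans_refl] at this
  simpa using this

theorem F_symm {x y : X} (p : Path x y) : R.F p.symm = (R.F p)⁻¹ := by
  have h := R.homot _ _ ⟨Path.Homotopy.reflTransSymm p⟩
  rw [R.F_refl, R.trans] at h
  exact eq_inv_of_mul_eq_one_left h.symm

theorem F_cast {x y x' y' : X} (p : Path x y) (hx : x' = x) (hy : y' = y) :
    R.F (p.cast hx hy) = R.F p := by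
  subst hx; subst hy; rfl

/-- The induced homomorphism on the fundamental group. -/
noncomputable def hom (x : X) : FundamentalGroup X x →* G where
  toFun g := Quotient.lift (s := Path.Homotopic.setoid x x) (fun p : Path x x => R.F p)
    (fun p q h => R.homot p q h) g
  map_one' := R.F_refl x
  map_mul' := by
    intro a b
    refine Quotient.inductionOn₂ (s₁ := Path.Homotopic.setoid x x)
      (s₂ := Path.Homotopic.setoid x x) a b ?_
    intro p q
    exact R.trans q p

theorem hom_mk (x : X) (p : Path x x) :
    R.hom x (FundamentalGroup.fromPath (Path.Homotopic.Quotient.mk p)) = R.F p := rfl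

theorem hom_loopClass {x y : X} (α : Path x y) (β : Path y y) (h : R.F β = 1) :
    R.hom x (loopClass α β) = 1 := by
  have : R.hom x (loopClass α β) = R.F ((α.trans β).trans α.symm) := rfl
  rw [this, R.trans, R.trans, R.F_symm, h]; simp

end PRep

section holonomy
variable {G : Type*} [Group G]

/-- Local cocycles. -/
def LocCoc {Q : Type*} [MetricSpace Q] (c : Q → Q → G) (η : ℝ) : Prop :=
  ∀ x y z, dist x y < η → dist y z < η → dist x z < η → c y z * c x y = c x z

/-- Local primitive of a cocycle. -/
def IsPrim {Q : Type*} [MetricSpace Q] (c : Q → Q → G) (h : Q → G) : Prop :=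
  ∃ η > 0, ∀ x y, dist x y < η → h y = c x y * h x

theorem LocCoc.comp {Q Z : Type*} [MetricSpace Q] [CompactSpace Q] [MetricSpace Z]
    {c : Z → Z → G} {η : ℝ} (hη : 0 < η) (hc : LocCoc c η) (u : Q → Z) (hu : Continuous u) :
    ∃ η' > 0, LocCoc (fun x y => c (u x) (u y)) η' := by
  have huc := CompactSpace.uniformContinuous_of_continuous hu
  rw [Metric.uniformContinuous_iff] at huc
  obtain ⟨η', h0, h⟩ := huc η hη
  exact ⟨η', h0, fun x y z h1 h2 h3 => hc _ _ _ (h h1) (h h2) (h h3)⟩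

theorem exists_prim {Q : Type*} [MetricSpace Q] [CompactSpace Q] (k : I × Q → Q)
    (hk : Continuous k) (q : Q) (hk0 : ∀ x, k (0, x) = q) (hk1 : ∀ x, k (1, x) = x)
    (c : Q → Q → G) (η : ℝ) (hη : 0 < η) (hc : LocCoc c η) :
    ∃ h, IsPrim c h := by
  have huc := CompactSpace.uniformContinuous_of_continuous hk
  rw [Metric.uniformContinuous_iff] at huc
  obtain ⟨η', h0, hU⟩ := huc (η / 2) (by linarith)
  obtain ⟨n, hn⟩ := exists_nat_one_div_lt h0
  let τ : ℕ → I := fun i => Set.projIcc 0 1 zero_le_one ((i : ℝ) / (n + 1))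
  have hτ0 : τ 0 = 0 := by simp [τ, Set.projIcc_of_le_left]
  have hτn : τ (n + 1) = 1 := by
    have : ((n + 1 : ℕ) : ℝ) / (n + 1) = 1 := by
      push_cast; field_simp
    simp only [τ, this]; simp
  have hτd : ∀ i, dist (τ i) (τ (i + 1)) < η' := by
    intro i
    have h1 : dist (τ i) (τ (i + 1)) ≤ dist ((i : ℝ) / (n + 1)) (((i + 1 : ℕ) : ℝ) / (n + 1)) := by
      simpa [τ] using (LipschitzWith.projIcc (zero_le_one (α := ℝ))).dist_le_mul
        ((i : ℝ) / (n + 1)) (((i + 1 : ℕ) : ℝ) / (n + 1))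
    refine h1.trans_lt ?_
    rw [Real.dist_eq, ← sub_div]
    have : (i : ℝ) - ((i + 1 : ℕ) : ℝ) = -1 := by push_cast; ring
    rw [this, neg_div, abs_neg, abs_of_pos (by positivity)]
    exact hn
  let φ : ℕ → Q → Q := fun i x => k (τ i, x)
  let hh : ℕ → Q → G := fun i => Nat.rec (fun _ => 1)
    (fun i r x => c (φ i x) (φ (i + 1) x) * r x) i
  have hstep : ∀ i x, hh (i + 1) x = c (φ i x) (φ (i + 1) x) * hh i x := fun _ _ => rfl
  have hd1 : ∀ i x, dist (φ i x) (φ (i + 1) x) < η / 2 := by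
    intro i x
    apply hU
    rw [Prod.dist_eq]; simp [hτd i]
  have hd2 : ∀ i x y, dist x y < η' → dist (φ i x) (φ i y) < η / 2 := by
    intro i x y h
    apply hU
    rw [Prod.dist_eq]; simp [h]
  have key : ∀ x y, dist x y < η' → ∀ i, c (φ i x) (φ i y) * hh i x = hh i y := by
    intro x y hxy i
    induction i with
    | zero =>
      have e : ∀ x, φ 0 x = q := fun x => by simp only [φ, hτ0, hk0]
      rw [e, e]
      have := hc q q q (by simpa) (by simpa) (by simpa)
      have h1 : c q q = 1 := by simpa using this
      rw [h1, one_mul]; rfl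
    | succ i ih =>
      have a1 := hd1 i x
      have a2 := hd1 i y
      have a3 := hd2 i x y hxy
      have a4 := hd2 (i + 1) x y hxy
      have a5 := dist_triangle (φ i x) (φ i y) (φ (i + 1) y)
      rw [hstep, hstep, ← ih, ← mul_assoc, ← mul_assoc,
        hc _ _ _ (by linarith) (by linarith) (by linarith),
        hc _ _ _ (by linarith) (by linarith) (by linarith)]
  refine ⟨hh (n + 1), η', h0, fun x y hxy => ?_⟩
  have e : ∀ x, φ (n + 1) x = x := fun x => by simp only [φ, hτn, hk1]
  have := key x y hxy (n + 1)
  rw [e, e] at this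
  exact this.symm

variable {Z : Type*} [MetricSpace Z]

theorem exists_prim_path {c : Z → Z → G} {η : ℝ} (hη : 0 < η) (hc : LocCoc c η)
    {x y : Z} (γ : Path x y) : ∃ h, IsPrim (fun s t => c (γ s) (γ t)) h := by
  obtain ⟨η', h0, hc'⟩ := hc.comp hη γ γ.continuous
  exact exists_prim (fun a : I × I => a.1 * a.2) (by fun_prop) 0 (by simp) (by simp) _ η' h0 hc'

theorem IsPrim.unique {c : I → I → G} {h h' : I → G} (H : IsPrim c h) (H' : IsPrim c h') :
    h 1 * (h 0)⁻¹ = h' 1 * (h' 0)⁻¹ := by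
  obtain ⟨η, h0, hh⟩ := H
  obtain ⟨η', h0', hh'⟩ := H'
  refine interval_ind (fun t => h t * (h 0)⁻¹ = h' t * (h' 0)⁻¹) (by simp) (min η η')
    (lt_min h0 h0') ?_ 1
  intro s t hst ih
  rw [hh s t (hst.trans_le (min_le_left _ _)), hh' s t (hst.trans_le (min_le_right _ _)),
    mul_assoc, ih, mul_assoc]

open Classical in
/-- Holonomy of a cocycle along a path. -/
noncomputable def hol (c : Z → Z → G) {x y : Z} (γ : Path x y) : G :=
  if H : ∃ h, IsPrim (fun s t => c (γ s) (γ t)) h then H.choose 1 * (H.choose 0)⁻¹ else 1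

theorem hol_eq {c : Z → Z → G} {x y : Z} (γ : Path x y) {h : I → G}
    (H : IsPrim (fun s t => c (γ s) (γ t)) h) : hol c γ = h 1 * (h 0)⁻¹ := by
  have hex : ∃ h, IsPrim (fun s t => c (γ s) (γ t)) h := ⟨h, H⟩
  rw [hol, dif_pos hex]
  exact hex.choose_spec.unique H

theorem hol_trans {c : Z → Z → G} {η : ℝ} (hη : 0 < η) (hc : LocCoc c η)
    {x y z : Z} (p : Path x y) (q : Path y z) : hol c (p.trans q) = hol c q * hol c p := by
  obtain ⟨h, H⟩ := exists_prim_path hη hc (p.trans q)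
  let u : I → I := fun t => ⟨(t : ℝ) / 2, by constructor <;> linarith [t.2.1, t.2.2]⟩
  let v : I → I := fun t => ⟨(1 + (t : ℝ)) / 2, by constructor <;> linarith [t.2.1, t.2.2]⟩
  have hu : ∀ t, (p.trans q) (u t) = p t := by
    intro t
    have : (t : ℝ) / 2 ≤ 1 / 2 := by linarith [t.2.2]
    rw [Path.trans_apply, dif_pos this]
    congr 1; ext; simp [u]; ring
  have hv : ∀ t, (p.trans q) (v t) = q t := by
    intro t
    rw [Path.trans_apply]
    split_ifs with h
    · have h' : (1 + (t : ℝ)) / 2 ≤ 1 / 2 := h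
      have ht : t = 0 := by
        ext; apply le_antisymm _ t.2.1
        change (t : ℝ) ≤ 0; linarith
      subst ht
      rw [q.source]
      convert p.target
      simp [v]
    · congr 1; ext; simp [v]; ring
  rw [hol_eq _ H]
  obtain ⟨η', h0, hh⟩ := H
  have Hp : IsPrim (fun s t => c (p s) (p t)) (h ∘ u) := by
    refine ⟨η', h0, fun s t hst => ?_⟩
    have := hh (u s) (u t) (by
      rw [Subtype.dist_eq, Real.dist_eq] at hst ⊢
      simp only [u]
      rw [← sub_div, abs_div]
      have := abs_nonneg ((s : ℝ) - t)
      norm_num; linarith)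
    simp only [hu] at this
    exact this
  have Hq : IsPrim (fun s t => c (q s) (q t)) (h ∘ v) := by
    refine ⟨η', h0, fun s t hst => ?_⟩
    have := hh (v s) (v t) (by
      rw [Subtype.dist_eq, Real.dist_eq] at hst ⊢
      simp only [v]
      rw [← sub_div, abs_div]
      have := abs_nonneg ((s : ℝ) - t)
      norm_num; linarith)
    simp only [hv] at this
    exact this
  rw [hol_eq _ Hp, hol_eq _ Hq]
  have e0 : u 0 = 0 := by ext; simp [u]
  have e1 : v 1 = 1 := by ext; simp [v]
  have e2 : u 1 = v 0 := by ext; simp [u, v]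
  simp [e0, e1, e2]

theorem hol_homot {c : Z → Z → G} {η : ℝ} (hη : 0 < η) (hc : LocCoc c η)
    {x y : Z} (p q : Path x y) (hpq : p.Homotopic q) : hol c p = hol c q := by
  obtain ⟨H⟩ := hpq
  obtain ⟨η', h0, hc'⟩ := hc.comp hη H H.continuous
  obtain ⟨h, η₁, h1, hh⟩ := exists_prim (fun a : I × (I × I) => (a.1 * a.2.1, a.1 * a.2.2))
    (by fun_prop) (0, 0) (by simp) (by simp) _ η' h0 hc'
  have hcc : ∀ x, c x x = 1 := fun x => by
    simpa using hc x x x (by simpa) (by simpa) (by simpa)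
  have Hp : IsPrim (fun s t => c (p s) (p t)) (fun t => h (0, t)) := by
    refine ⟨η₁, h1, fun s t hst => ?_⟩
    have := hh (0, s) (0, t) (by rw [Prod.dist_eq]; simp [hst, h1])
    simpa using this
  have Hq : IsPrim (fun s t => c (q s) (q t)) (fun t => h (1, t)) := by
    refine ⟨η₁, h1, fun s t hst => ?_⟩
    have := hh (1, s) (1, t) (by rw [Prod.dist_eq]; simp [hst, h1])
    simpa using this
  rw [hol_eq _ Hp, hol_eq _ Hq]
  have E0 : ∀ t, h (t, 0) = h (0, 0) := by
    refine interval_ind _ rfl η₁ h1 fun s t hst ih => ?_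
    have := hh (s, 0) (t, 0) (by rw [Prod.dist_eq]; simp [hst, h1])
    rw [this, ih]; simp [hcc]
  have E1 : ∀ t, h (t, 1) = h (0, 1) := by
    refine interval_ind _ rfl η₁ h1 fun s t hst ih => ?_
    have := hh (s, 1) (t, 1) (by rw [Prod.dist_eq]; simp [hst, h1])
    rw [this, ih]; simp [hcc]
  simp only [E0 1, E1 1]

/-- Holonomy as a path representation. -/
noncomputable def holRep {c : Z → Z → G} {η : ℝ} (hη : 0 < η) (hc : LocCoc c η) : PRep Z G where
  F := fun p => hol c p
  trans := hol_trans hη hc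
  homot := hol_homot hη hc

end holonomy

theorem geod_exists {X : Type*} [MetricSpace X] (h : IsGeodesicSpace X) (x y : X) :
    ∃ γ : Path x y, ∀ t, dist x (γ t) ≤ dist x y := by
  obtain ⟨γ, hγ⟩ := h x y
  refine ⟨γ, fun t => ?_⟩
  have h1 : edist (γ 0) (γ t) ≤ eVariationOn γ Set.univ :=
    eVariationOn.edist_le _ (Set.mem_univ _) (Set.mem_univ _)
  rw [pathLength] at hγ
  rw [hγ, γ.source, edist_dist] at h1
  exact (ENNReal.ofReal_le_ofReal_iff dist_nonneg).mp h1

/-- The class of a path, via chosen connections to the base point. -/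
noncomputable def quotRep {X : Type*} [TopologicalSpace X] (p : X) (sg : ∀ x, Path p x)
    (N : Subgroup (FundamentalGroup X p)) [N.Normal] : PRep X (FundamentalGroup X p ⧸ N) where
  F := fun {x y} γ => QuotientGroup.mk' N (FundamentalGroup.fromPath
    (Path.Homotopic.Quotient.mk (((sg x).trans γ).trans (sg y).symm)))
  trans := by
    intro x y z a b
    rw [← map_mul]
    congr 1
    change _ = Path.Homotopic.Quotient.trans _ _
    simp only [Path.Homotopic.Quotient.mk_trans, Path.Homotopic.Quotient.mk_symm,
      Path.Homotopic.Quotient.trans_assoc]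
    rw [← Path.Homotopic.Quotient.trans_assoc (Path.Homotopic.Quotient.mk (sg y)).symm,
      Path.Homotopic.Quotient.symm_trans, Path.Homotopic.Quotient.refl_trans]
  homot := by
    intro x y a b h
    have : Path.Homotopic.Quotient.mk a = Path.Homotopic.Quotient.mk b :=
      Path.Homotopic.Quotient.eq.mpr h
    simp only [Path.Homotopic.Quotient.mk_trans, this]

theorem quotRep_loop {X : Type*} [TopologicalSpace X] (p : X) (sg : ∀ x, Path p x)
    (N : Subgroup (FundamentalGroup X p)) [N.Normal] {y : X} (β : Path y y)
    (h : loopClass (sg y) β ∈ N) : (quotRep p sg N).F β = 1 :=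
  (QuotientGroup.eq_one_iff (N := N) _).mpr h

theorem quotRep_surj {X : Type*} [TopologicalSpace X] (p : X) (sg : ∀ x, Path p x)
    (N : Subgroup (FundamentalGroup X p)) [N.Normal] (g : FundamentalGroup X p ⧸ N) :
    ∃ γ : Path p p, (quotRep p sg N).F γ = g := by
  obtain ⟨g, rfl⟩ := QuotientGroup.mk'_surjective N g
  obtain ⟨ω, rfl⟩ := Path.Homotopic.Quotient.mk_surjective g
  refine ⟨((sg p).symm.trans ω).trans (sg p), ?_⟩
  change QuotientGroup.mk' N _ = _
  congr 1
  change Path.Homotopic.Quotient.mk _ = Path.Homotopic.Quotient.mk _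
  simp only [Path.Homotopic.Quotient.mk_trans, Path.Homotopic.Quotient.mk_symm,
      Path.Homotopic.Quotient.trans_assoc]
  rw [Path.Homotopic.Quotient.trans_symm, Path.Homotopic.Quotient.trans_refl,
    ← Path.Homotopic.Quotient.trans_assoc, 
      Path.Homotopic.Quotient.trans_symm, Path.Homotopic.Quotient.refl_trans]

/-- Paths with the same endpoints in a set all of whose loops are trivial. -/
theorem PRep.F_eq {X : Type*} [TopologicalSpace X] {G : Type*} [Group G] (R : PRep X G)
    {S : Set X} (hS : ∀ (y : X) (β : Path y y), (∀ t, β t ∈ S) → R.F β = 1)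
    {x y : X} (p q : Path x y) (hp : ∀ t, p t ∈ S) (hq : ∀ t, q t ∈ S) : R.F p = R.F q := by
  have h := hS x (p.trans q.symm) (by
    intro t
    have : (p.trans q.symm) t ∈ Set.range (p.trans q.symm) := ⟨t, rfl⟩
    rw [Path.trans_range, Path.symm_range] at this
    rcases this with ⟨s, hs⟩ | ⟨s, hs⟩
    · rw [← hs]; exact hp s
    · rw [← hs]; exact hq s)
  rw [R.trans, R.F_symm, inv_mul_eq_one] at h
  exact h.symm

theorem trans_mem {X : Type*} [TopologicalSpace X] {S : Set X} {x y z : X} (p : Path x y)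
    (q : Path y z) (hp : ∀ t, p t ∈ S) (hq : ∀ t, q t ∈ S) (t : I) : (p.trans q) t ∈ S := by
  have : (p.trans q) t ∈ Set.range (p.trans q) := ⟨t, rfl⟩
  rw [Path.trans_range] at this
  rcases this with ⟨s, hs⟩ | ⟨s, hs⟩
  · rw [← hs]; exact hp s
  · rw [← hs]; exact hq s

theorem shadow {Z₁ Z₂ : Type*} [MetricSpace Z₁] [MetricSpace Z₂] {G : Type*} [Group G]
    (R : PRep Z₂ G) (g : ∀ x y : Z₂, Path x y) (f : Z₁ → Z₂) (ε : ℝ) (hε : 0 < ε)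
    (hc : LocCoc (fun a b => R.F (g (f a) (f b))) ε) {x y : Z₁} (β : Path x y) (S : Set Z₂)
    (hS : ∀ s t, dist (β s) (β t) < ε → ∀ u, g (f (β s)) (f (β t)) u ∈ S) :
    ∃ ω : Path (f x) (f y), (∀ u, ω u ∈ S) ∧
      R.F ω = hol (fun a b => R.F (g (f a) (f b))) β := by
  obtain ⟨h, H⟩ := exists_prim_path hε hc β
  rw [hol_eq β H]
  obtain ⟨η, h0, hh⟩ := H
  have huc := CompactSpace.uniformContinuous_of_continuous β.continuous
  rw [Metric.uniformContinuous_iff] at huc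
  obtain ⟨η', h0', hU⟩ := huc ε hε
  refine interval_ind (fun t => ∀ y', y' = β t → ∃ ω : Path (f x) (f y'), (∀ u, ω u ∈ S) ∧
      R.F ω = h t * (h 0)⁻¹) ?_ (min η η') (lt_min h0 h0') ?_ 1 y β.target.symm
  · intro y' hy'
    obtain rfl : y' = x := by rw [hy', β.source]
    refine ⟨g _ _, ?_, ?_⟩
    · have := hS 0 0 (by simpa)
      rwa [β.source] at this
    · have := hc y' y' y' (by simpa) (by simpa) (by simpa)
      simpa using this
  · intro s t hst ih y' hy'
    subst hy'
    obtain ⟨ω, hω, hF⟩ := ih _ rfl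
    refine ⟨ω.trans (g _ _), ?_, ?_⟩
    · exact trans_mem _ _ hω (hS s t (hU (hst.trans_le (min_le_right _ _))))
    · rw [R.trans, hF, hh s t (hst.trans_le (min_le_left _ _)), mul_assoc]

theorem surj_core {Z₁ Z₂ : Type*} [MetricSpace Z₁] [MetricSpace Z₂] {G : Type*} [Group G]
    (p₁ : Z₁) (p₂ : Z₂) (ε : ℝ) (hε : 0 < ε) (f : Z₁ → Z₂) (hfp : f p₁ = p₂)
    (hfs : ∀ z : Z₂, ∃ a : Z₁, dist z (f a) ≤ ε)
    (g₁ : ∀ x y : Z₁, Path x y) (g : ∀ x y : Z₂, Path x y)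
    (hg : ∀ x y t, dist x (g x y t) ≤ dist x y) (δ₂ : ℝ) (hδ₂ : 8 * ε ≤ δ₂)
    (R : PRep Z₂ G) (T : PRep Z₁ G)
    (hball : ∀ (c : Z₂) (r : ℝ), r ≤ δ₂ → ∀ (y : Z₂) (β : Path y y),
      (∀ t, β t ∈ ball c r) → R.F β = 1)
    (hshort : ∀ a b : Z₁, dist (f a) (f b) ≤ 3 * ε → ∃ ω : Path (f a) (f b),
      (∀ u, ω u ∈ ball (f a) (8 * ε)) ∧ R.F ω = T.F (g₁ a b))
    (γ : Path p₂ p₂) : ∃ ω : Path p₁ p₁, T.F ω = R.F γ := by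
  have huc := CompactSpace.uniformContinuous_of_continuous γ.continuous
  rw [Metric.uniformContinuous_iff] at huc
  obtain ⟨η, h0, hU⟩ := huc ε hε
  have key : ∀ t : I, ∃ (a : Z₁) (ω : Path p₁ a) (κ : Path (γ t) (f a)),
      dist (γ t) (f a) ≤ ε ∧ (∀ u, dist (γ t) (κ u) ≤ ε) ∧
      T.F ω = R.F κ * R.F (γ.subpath 0 t) := by
    refine interval_ind _ ?_ η h0 ?_
    · have e : γ 0 = f p₁ := by rw [γ.source, hfp]
      refine ⟨p₁, Path.refl _, (Path.refl (f p₁)).cast e rfl, ?_, ?_, ?_⟩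
      · rw [e]; simp [hε.le]
      · intro u; rw [Path.cast_coe, e]; simp [hε.le]
      · rw [T.F_refl, R.F_cast, R.F_refl, Path.subpath_self, R.F_refl, one_mul]
    · rintro s t hst ⟨a, ω, κ, ha, hκ, hF⟩
      obtain ⟨b, hb⟩ := hfs (γ t)
      have hst' := hU hst
      have hab : dist (f a) (f b) ≤ 3 * ε := by
        have h1 := dist_triangle4 (f a) (γ s) (γ t) (f b)
        rw [dist_comm (f a) (γ s)] at h1
        linarith
      obtain ⟨ν, hν, hνF⟩ := hshort a b hab
      have hκb : ∀ u, dist (γ t) (g (γ t) (f b) u) ≤ ε := fun u => (hg _ _ u).trans hb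
      refine ⟨b, ω.trans (g₁ a b), g (γ t) (f b), hb, hκb, ?_⟩
      have hsub : R.F (γ.subpath 0 t) = R.F (γ.subpath s t) * R.F (γ.subpath 0 s) := by
        rw [← R.trans]
        exact (R.homot _ _ ⟨Path.Homotopy.subpathTransSubpath γ 0 s t⟩).symm
      rw [T.trans, hF, ← hνF, hsub, ← mul_assoc, ← mul_assoc, ← R.trans κ ν,
        ← R.trans (γ.subpath s t)]
      congr 1
      refine R.F_eq (hball (f a) (8 * ε) (by linarith)) _ _ (trans_mem _ _ ?_ hν)
        (trans_mem _ _ ?_ ?_)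
      · intro u
        have h1 := hκ u
        have h2 := dist_triangle_left (f a) (κ u) (γ s)
        rw [mem_ball']; linarith
      · intro u
        have hmem : (γ.subpath s t) u ∈ Set.range (γ.subpath s t) := ⟨u, rfl⟩
        rw [Path.range_subpath] at hmem
        obtain ⟨r, hr, hru⟩ := hmem
        have hr' : dist s r < η := by
          refine lt_of_le_of_lt ?_ hst
          rw [Subtype.dist_eq, Subtype.dist_eq]
          have : (r : ℝ) ∈ Set.uIcc (s : ℝ) t := hr
          exact Real.dist_left_le_of_mem_uIcc this
        have h1 := hU hr'
        have h2 := dist_triangle_left (f a) (γ r) (γ s)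
        rw [← hru, mem_ball']; linarith
      · intro u
        have h1 := hκb u
        have h2 := dist_triangle_left (f a) (γ t) (γ s)
        have h3 := dist_triangle (f a) (γ t) (g (γ t) (f b) u)
        rw [mem_ball']; linarith
  obtain ⟨a, ω, κ, ha, hκ, hF⟩ := key 1
  have e1 : f p₁ = γ 1 := by rw [γ.target, hfp]
  obtain ⟨ν, hν, hνF⟩ := hshort a p₁ (by rw [e1, dist_comm]; linarith)
  refine ⟨ω.trans (g₁ a p₁), ?_⟩
  rw [T.trans, hF, ← hνF, Path.subpath_zero_one, R.F_cast, ← mul_assoc, ← R.trans]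
  have : R.F ((κ.trans ν).cast rfl e1.symm) = 1 := by
    apply hball (f a) (8 * ε) (by linarith)
    intro t
    rw [Path.cast_coe]
    refine trans_mem _ _ ?_ hν t
    intro u
    have h1 := hκ u
    have h2 := dist_triangle_left (f a) (κ u) (γ 1)
    rw [mem_ball']; linarith
  rw [R.F_cast] at this
  rw [this, one_mul]

/-- A pointed ε-Hausdorff approximation between compact geodesic spaces
induces a surjective homomorphism between the deck groups
`π₁(Z₁,p₁)/π₁^{cut}(Z₁,δ₁,s₁,p₁) → π₁(Z₂,p₂)/π₁^{cut}(Z₂,δ₂,s₂,p₂)` whenever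
`δ₁ > 10ε`, `δ₂ > δ₁ + 10ε` and `0 < s₂ < s₁ - 5ε`. -/
theorem surjective_quotient_hom_of_hausdorffApprox
    {Z₁ Z₂ : Type*} [MetricSpace Z₁] [MetricSpace Z₂]
    [CompactSpace Z₁] [CompactSpace Z₂]
    (hZ₁ : IsGeodesicSpace Z₁) (hZ₂ : IsGeodesicSpace Z₂)
    (p₁ : Z₁) (p₂ : Z₂) (ε : ℝ) (hε : 0 < ε)
    (f : Z₁ → Z₂) (hf : IsPointedHausdorffApprox f p₁ p₂ ε)
    (δ₁ δ₂ s₁ s₂ : ℝ) (hδ₁ : 10 * ε < δ₁) (hδ₂ : δ₁ + 10 * ε < δ₂)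
    (hs₁ : 0 < s₁) (hs₂0 : 0 < s₂) (hs₂ : s₂ < s₁ - 5 * ε) :
    ∃ Φ : (FundamentalGroup Z₁ p₁ ⧸ cutCoveringGroup Z₁ p₁ δ₁ s₁) →*
          (FundamentalGroup Z₂ p₂ ⧸ cutCoveringGroup Z₂ p₂ δ₂ s₂),
      Function.Surjective Φ := by
  obtain ⟨hfp, hfd, hfs⟩ := hf
  have hfd1 : ∀ a b, dist (f a) (f b) < dist a b + ε := fun a b => by
    linarith [(abs_lt.mp (hfd a b)).2]
  have hfd2 : ∀ a b, dist a b < dist (f a) (f b) + ε := fun a b => by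
    linarith [(abs_lt.mp (hfd a b)).1]
  choose g₁ hg₁ using geod_exists hZ₁
  choose g hg using geod_exists hZ₂
  let R := quotRep p₂ (g p₂) (cutCoveringGroup Z₂ p₂ δ₂ s₂)
  have hball : ∀ (c : Z₂) (r : ℝ), r ≤ δ₂ → ∀ (y : Z₂) (β : Path y y),
      (∀ t, β t ∈ ball c r) → R.F β = 1 := by
    intro c r hr y β h
    apply quotRep_loop
    exact Subgroup.subset_normalClosure
      ⟨y, β, g p₂ y, Or.inl ⟨c, fun t => ball_subset_ball hr (h t)⟩, rfl⟩
  have hout : ∀ (y : Z₂) (β : Path y y),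
      (∀ t, β t ∈ (closedBall p₂ s₂)ᶜ) → R.F β = 1 := by
    intro y β h
    apply quotRep_loop
    exact Subgroup.subset_normalClosure ⟨y, β, g p₂ y, Or.inr h, rfl⟩
  have hc : LocCoc (fun a b => R.F (g (f a) (f b))) ε := by
    intro x y z hxy hyz hxz
    simp only
    rw [← R.trans]
    have a1 := hfd1 x y
    have a2 := hfd1 y z
    have a3 := hfd1 x z
    refine R.F_eq (hball (f x) (5 * ε) (by linarith)) _ _ (trans_mem _ _ ?_ ?_) ?_
    · intro t
      have := hg (f x) (f y) t
      rw [mem_ball']; linarith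
    · intro t
      have := hg (f y) (f z) t
      have := dist_triangle (f x) (f y) (g (f y) (f z) t)
      rw [mem_ball']; linarith
    · intro t
      have := hg (f x) (f z) t
      rw [mem_ball']; linarith
  let T := holRep hε hc
  -- loops in a small ball
  have hT1 : ∀ (y : Z₁) (β : Path y y), (∃ c : Z₁, ∀ t, β t ∈ ball c δ₁) → T.F β = 1 := by
    rintro y β ⟨c, hβ⟩
    obtain ⟨ω, hω, hF⟩ := shadow R g f ε hε hc β (ball (f c) δ₂) (by
      intro s t hst u
      have h1 := hg (f (β s)) (f (β t)) u
      have h2 := hfd1 (β s) (β t)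
      have h3 := hfd1 c (β s)
      have h4 := hβ s
      rw [mem_ball'] at h4 ⊢
      have h5 := dist_triangle (f c) (f (β s)) (g (f (β s)) (f (β t)) u)
      linarith)
    have := hball (f c) δ₂ le_rfl _ ω hω
    exact hF.symm.trans this
  have hT2 : ∀ (y : Z₁) (β : Path y y), (∀ t, β t ∉ closedBall p₁ s₁) → T.F β = 1 := by
    rintro y β hβ
    obtain ⟨ω, hω, hF⟩ := shadow R g f ε hε hc β ((closedBall p₂ s₂)ᶜ) (by
      intro s t hst u
      have h1 := hg (f (β s)) (f (β t)) u
      have h2 := hfd1 (β s) (β t)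
      have h3 := hfd2 p₁ (β s)
      have h4 := hβ s
      rw [mem_closedBall', not_le] at h4
      rw [Set.mem_compl_iff, mem_closedBall', not_le]
      have h5 := dist_triangle_right p₂ (f (β s)) (g (f (β s)) (f (β t)) u)
      rw [hfp] at h3
      linarith)
    exact hF.symm.trans (hout _ ω hω)
  have hker : cutCoveringGroup Z₁ p₁ δ₁ s₁ ≤ (T.hom p₁).ker := by
    apply Subgroup.normalClosure_le_normal
    rintro _ ⟨y, β, α, h, rfl⟩
    apply T.hom_loopClass
    rcases h with h | h
    · exact hT1 y β h
    · exact hT2 y β h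
  -- short geodesics in the first space
  have hshort : ∀ a b : Z₁, dist (f a) (f b) ≤ 3 * ε → ∃ ω : Path (f a) (f b),
      (∀ u, ω u ∈ ball (f a) (8 * ε)) ∧ R.F ω = T.F (g₁ a b) := by
    intro a b hab
    refine shadow R g f ε hε hc (g₁ a b) _ ?_
    intro s t hst u
    have h0 := hg₁ a b s
    have h1 := hg (f (g₁ a b s)) (f (g₁ a b t)) u
    have h2 := hfd1 (g₁ a b s) (g₁ a b t)
    have h3 := hfd1 a (g₁ a b s)
    have h4 := hfd2 a b
    have h5 := dist_triangle (f a) (f (g₁ a b s)) (g (f (g₁ a b s)) (f (g₁ a b t)) u)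
    rw [mem_ball']
    linarith
  refine ⟨QuotientGroup.lift _ (T.hom p₁) hker, ?_⟩
  intro w
  obtain ⟨γ, rfl⟩ := quotRep_surj p₂ (g p₂) (cutCoveringGroup Z₂ p₂ δ₂ s₂) w
  change ∃ a, _ = R.F γ
  suffices hsuff : ∃ ω : Path p₁ p₁, T.F ω = R.F γ by
    obtain ⟨ω, hω⟩ := hsuff
    exact ⟨QuotientGroup.mk' _ (FundamentalGroup.fromPath (Path.Homotopic.Quotient.mk ω)), hω⟩
  exact surj_core p₁ p₂ ε hε f hfp hfs g₁ g hg δ₂ (by linarith) R T hball hshort γ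
end
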